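/- arXiv:math/0008155 — 8 statements merged into one kernel-verified Lean document; each statement's English description precedes it below -/
import Mathlib

section
/- Let m ≥ 2, let Q : ℝᵐ → ℝ be a quadratic polynomial, let c ∈ ℝ, and let P = {x ∈ ℝᵐ : Q(x) = c}. Let e₁,…,e_m be the standard basis of ℝᵐ and define χ : ℝᵐ → Λ^{m−1}ℝᵐ by χ(x) = ∑_{j=1}^m (−1)^{j−1} (∂Q/∂x_j)(x) · e₁∧⋯∧e_{j−1}∧e_{j+1}∧⋯∧e_m. Then χ is an affine map, and is linear if Q is a homogeneous quadratic polynomial; and for every p ∈ P at which the differential dQ(p) is nonzero, χ(p) is a nonzero element of the image of Λ^{m−1}(ker dQ(p)) in Λ^{m−1}ℝᵐ, i.e. χ(p) is a nonzero element of Λ^{m−1}T_pP, where T_pP = ker dQ(p) is the tangent space to the quadric P at p. -/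
/-- The span of all `k`-fold wedge products of elements of a subspace `W`:
the image of `Λ^k W` inside the exterior algebra. -/
def wedgeSpan {E : Type*} [AddCommGroup E] [Module ℝ E] (W : Submodule ℝ E) (k : ℕ) :
    Submodule ℝ (ExteriorAlgebra ℝ E) :=
  Submodule.span ℝ {ξ | ∃ v : Fin k → E, (∀ i, v i ∈ W) ∧
    ξ = (List.ofFn fun i => ExteriorAlgebra.ι ℝ (v i)).prod}

/-- The `i`-th element of `{0, …, m−1} ∖ {j}`, listed in increasing order. -/
def omitIdx {m : ℕ} (j : Fin m) (i : Fin (m - 1)) : Fin m :=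
  if (i : ℕ) < (j : ℕ) then ⟨i, by have := i.isLt; omega⟩
  else ⟨(i : ℕ) + 1, by have := i.isLt; omega⟩

/-- The wedge product `e₁ ∧ ⋯ ∧ e_{j−1} ∧ e_{j+1} ∧ ⋯ ∧ e_m` of the standard basis
vectors of `ℝᵐ` omitting the `j`-th one. -/
noncomputable def omitWedge (m : ℕ) (j : Fin m) : ExteriorAlgebra ℝ (Fin m → ℝ) :=
  (List.ofFn fun i : Fin (m - 1) =>
    ExteriorAlgebra.ι ℝ (Pi.single (omitIdx j i) (1 : ℝ))).prod

/-- Interior multiplication of a wedge product of vectors by a linear form. -/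
theorem contractLeft_ιMulti {R M : Type*} [CommRing R] [AddCommGroup M] [Module R M]
    (d : Module.Dual R M) {n : ℕ} (v : Fin (n + 1) → M) :
    CliffordAlgebra.contractLeft (Q := (0 : QuadraticForm R M)) d (ExteriorAlgebra.ιMulti R _ v) =
      ∑ j : Fin (n + 1), ((-1 : R) ^ (j : ℕ) * d (v j)) •
        ExteriorAlgebra.ιMulti R n (v ∘ j.succAbove) := by
  induction n with
  | zero =>
    rw [ExteriorAlgebra.ιMulti_succ_apply]
    simp only [ExteriorAlgebra.ιMulti_zero_apply, mul_one]
    rw [CliffordAlgebra.contractLeft_ι]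
    simp [Algebra.algebraMap_eq_smul_one]
  | succ n ih =>
    rw [ExteriorAlgebra.ιMulti_succ_apply, CliffordAlgebra.contractLeft_ι_mul, ih,
      Fin.sum_univ_succ (n := n + 1), sub_eq_add_neg, Finset.mul_sum, ← Finset.sum_neg_distrib]
    congr 1
    · simp [Matrix.vecTail, Function.comp_def]
    · refine Finset.sum_congr rfl fun j _ => ?_
      have h : ExteriorAlgebra.ιMulti R (n + 1) (v ∘ j.succ.succAbove) =
          ExteriorAlgebra.ι R (v 0) *
            ExteriorAlgebra.ιMulti R n (Matrix.vecTail v ∘ j.succAbove) := by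
        rw [ExteriorAlgebra.ιMulti_succ_apply]
        simp [Matrix.vecTail, Function.comp_def]
      rw [h, mul_smul_comm, ← neg_smul]
      congr 1
      simp [Matrix.vecTail, pow_succ]

/-- An alternating map in top degree is determined by its value on a basis. -/
theorem alternatingMap_apply_eq_det_smul {R M N ι : Type*} [CommRing R] [AddCommGroup M]
    [Module R M] [AddCommGroup N] [Module R N] [Fintype ι] [DecidableEq ι]
    (e : Module.Basis ι R M) (f : M [⋀^ι]→ₗ[R] N) (v : ι → M) : f v = e.det v • f e := by
  suffices f = (LinearMap.toSpanSingleton R N (f e)).compAlternatingMap e.det by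
    conv_lhs => rw [this]
    simp
  refine Module.Basis.ext_alternating e fun i h => ?_
  let σ : Equiv.Perm ι := Equiv.ofBijective i (Finite.injective_iff_bijective.1 h)
  change f (e ∘ σ) = LinearMap.toSpanSingleton R N (f e) (e.det (e ∘ σ))
  simp only [AlternatingMap.map_perm, Module.Basis.det_self, LinearMap.toSpanSingleton_apply]
  rcases Int.units_eq_one_or (Equiv.Perm.sign σ) with h | h <;> simp [h]

/-- The wedge product of the vectors of a basis does not vanish. -/
theorem ιMulti_basis_ne_zero {R M : Type*} [CommRing R] [Nontrivial R] [AddCommGroup M]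
    [Module R M] {n : ℕ} (e : Module.Basis (Fin n) R M) : ExteriorAlgebra.ιMulti R n e ≠ 0 := by
  intro h
  have := exteriorPower.alternatingMapLinearEquiv_apply_ιMulti e.det e
  rw [show exteriorPower.ιMulti R n e = 0 from Subtype.ext h, map_zero, e.det_self] at this
  exact zero_ne_one this

/-- A nonzero linear form on a space of dimension `n + 1` admits a basis whose first vector lies
outside the kernel and whose other vectors form a basis of the kernel. -/
theorem exists_basis_adapted_to_ker {K V : Type*} [Field K] [AddCommGroup V] [Module K V]
    {n : ℕ} (b : Module.Basis (Fin (n + 1)) K V) {d : Module.Dual K V} (hd : d ≠ 0) :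
    ∃ w : Module.Basis (Fin (n + 1)) K V, d (w 0) ≠ 0 ∧ ∀ i : Fin n, d (w i.succ) = 0 := by
  have := Module.Basis.finiteDimensional_of_finite b
  obtain ⟨u, hu⟩ : ∃ u, d u ≠ 0 := by
    by_contra! h
    exact hd (LinearMap.ext h)
  have hker : Module.finrank K (LinearMap.ker d) = n := by
    have h := d.finrank_ker_add_one_of_ne_zero hd
    rw [Module.finrank_eq_card_basis b, Fintype.card_fin] at h
    omega
  let k := Module.finBasisOfFinrankEq K (LinearMap.ker d) hker
  let w := Module.Basis.mkFinCons u k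
    (fun a x hx h => by
      have := congrArg d h
      rw [LinearMap.mem_ker] at hx
      simpa [hx, hu] using this)
    (fun z => ⟨-(d z / d u), by simp [hu]⟩)
  refine ⟨w, ?_, fun i => ?_⟩
  · simpa [w] using hu
  · simp [w]

/-- Contracting a nonzero volume element with a nonzero linear form `d` gives a nonzero element of
the top exterior power of `ker d`. -/
theorem contractLeft_ιMulti_basis_mem_and_ne_zero {V : Type*} [AddCommGroup V] [Module ℝ V]
    {n : ℕ} (b : Module.Basis (Fin (n + 1)) ℝ V) {d : Module.Dual ℝ V} (hd : d ≠ 0) :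
    CliffordAlgebra.contractLeft (Q := (0 : QuadraticForm ℝ V)) d (ExteriorAlgebra.ιMulti ℝ _ b) ∈
        wedgeSpan (LinearMap.ker d) n ∧
      CliffordAlgebra.contractLeft (Q := (0 : QuadraticForm ℝ V)) d
        (ExteriorAlgebra.ιMulti ℝ _ b) ≠ 0 := by
  obtain ⟨w, hw0, hw⟩ := exists_basis_adapted_to_ker b hd
  have key : CliffordAlgebra.contractLeft (Q := (0 : QuadraticForm ℝ V)) d
      (ExteriorAlgebra.ιMulti ℝ _ b) =
      (w.det b * d (w 0)) • ExteriorAlgebra.ιMulti ℝ n (Matrix.vecTail w) := by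
    rw [alternatingMap_apply_eq_det_smul w, map_smul, contractLeft_ιMulti, Fin.sum_univ_succ,
      mul_smul]
    simp [hw, Matrix.vecTail, Function.comp_def, smul_smul]
  rw [key]
  refine ⟨Submodule.smul_mem _ _ (Submodule.subset_span ⟨_, hw, rfl⟩), smul_ne_zero
    (mul_ne_zero (w.isUnit_det b).ne_zero hw0) fun h => ιMulti_basis_ne_zero w ?_⟩
  rw [ExteriorAlgebra.ιMulti_succ_apply, h, mul_zero]

theorem omitIdx_eq_succAbove {n : ℕ} (j : Fin (n + 1)) (i : Fin n) :
    omitIdx j i = j.succAbove i := by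
  ext
  simp only [omitIdx, Fin.succAbove, Fin.lt_def]
  split_ifs <;> simp_all; omega

theorem omitWedge_eq_ιMulti {n : ℕ} (j : Fin (n + 1)) :
    omitWedge (n + 1) j =
      ExteriorAlgebra.ιMulti ℝ n (Pi.basisFun ℝ (Fin (n + 1)) ∘ j.succAbove) := by
  rw [ExteriorAlgebra.ιMulti_apply]
  simp only [Function.comp_apply, Pi.basisFun_apply, ← omitIdx_eq_succAbove]
  rfl

theorem sum_smul_omitWedge_eq_contractLeft {n : ℕ} (d : Module.Dual ℝ (Fin (n + 1) → ℝ)) :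
    ∑ j : Fin (n + 1), ((-1 : ℝ) ^ (j : ℕ) * d (Pi.single j 1)) • omitWedge (n + 1) j =
      CliffordAlgebra.contractLeft (Q := (0 : QuadraticForm ℝ (Fin (n + 1) → ℝ))) d
        (ExteriorAlgebra.ιMulti ℝ _ (Pi.basisFun ℝ (Fin (n + 1)))) := by
  rw [contractLeft_ιMulti]
  refine Finset.sum_congr rfl fun j _ => ?_
  rw [omitWedge_eq_ιMulti, Pi.basisFun_apply]

/-- Theorem 4.1: for a quadratic polynomial
`Q(x) = ∑_{i,j} A_{ij} x_i x_j + ∑_i b_i x_i + c₀` on `ℝᵐ`, the map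
`χ(x) = ∑_j (−1)^{j−1} (∂Q/∂x_j)(x) · e₁∧⋯∧ê_j∧⋯∧e_m` is affine (linear if `Q` is
homogeneous), and at every point `p` of the quadric `{Q = c}` at which `dQ(p) ≠ 0`,
`χ(p)` is a nonzero element of `Λ^{m−1}(ker dQ(p)) = Λ^{m−1} T_p P`. -/
theorem quadric_gives_evolution_data
    (m : ℕ) (hm : 2 ≤ m)
    (A : Matrix (Fin m) (Fin m) ℝ) (b : Fin m → ℝ) (c₀ c : ℝ)
    (Q : (Fin m → ℝ) → ℝ)
    (hQ : ∀ x, Q x = ∑ i, ∑ j, A i j * x i * x j + ∑ i, b i * x i + c₀)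
    (grad : (Fin m → ℝ) → Fin m → ℝ)
    (hgrad : ∀ x j, grad x j = (∑ i, (A j i + A i j) * x i) + b j)
    (dQ : (Fin m → ℝ) → (Fin m → ℝ) →ₗ[ℝ] ℝ)
    (hdQ : ∀ x, dQ x = ∑ j, grad x j • (LinearMap.proj j : (Fin m → ℝ) →ₗ[ℝ] ℝ))
    (P : Set (Fin m → ℝ)) (hP : P = {x | Q x = c})
    (χ : (Fin m → ℝ) → ExteriorAlgebra ℝ (Fin m → ℝ))
    (hχ : ∀ x, χ x = ∑ j : Fin m, ((-1 : ℝ) ^ (j : ℕ) * grad x j) • omitWedge m j) :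
    -- `χ` is an affine map
    (∃ (ξ₀ : ExteriorAlgebra ℝ (Fin m → ℝ))
        (L : (Fin m → ℝ) →ₗ[ℝ] ExteriorAlgebra ℝ (Fin m → ℝ)),
      ∀ x, χ x = ξ₀ + L x) ∧
    -- `χ` is linear if `Q` is homogeneous quadratic
    ((b = 0 ∧ c₀ = 0) →
      ∃ L : (Fin m → ℝ) →ₗ[ℝ] ExteriorAlgebra ℝ (Fin m → ℝ), ∀ x, χ x = L x) ∧
    -- at nonsingular points of `P`, `χ(p)` is a nonzero element of `Λ^{m−1} T_pP`
    (∀ p ∈ P, dQ p ≠ 0 →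
      χ p ∈ wedgeSpan (LinearMap.ker (dQ p)) (m - 1) ∧ χ p ≠ 0) := by
  let T : (Fin m → ℝ) →ₗ[ℝ] ExteriorAlgebra ℝ (Fin m → ℝ) :=
    ∑ j, (LinearMap.proj j).smulRight ((-1 : ℝ) ^ (j : ℕ) • omitWedge m j)
  have hT : ∀ x, χ x = T b + (T ∘ₗ (A + A.transpose).mulVecLin) x := by
    intro x
    have hg : grad x = b + (A + A.transpose).mulVecLin x := by
      ext j
      simp only [hgrad, Pi.add_apply, Matrix.mulVecLin_apply, Matrix.mulVec, dotProduct,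
        Matrix.add_apply, Matrix.transpose_apply, add_comm]
    rw [LinearMap.comp_apply, ← map_add, ← hg, hχ]
    simp [T, smul_smul, mul_comm]
  refine ⟨⟨T b, _, hT⟩, fun h => ⟨T ∘ₗ (A + A.transpose).mulVecLin, fun x => ?_⟩, ?_⟩
  · rw [hT, h.1, map_zero, zero_add]
  · intro p _ hp
    obtain ⟨n, rfl⟩ : ∃ n, m = n + 1 := ⟨m - 1, by omega⟩
    have hd : ∀ j, grad p j = dQ p (Pi.single j 1) := by
      intro j
      simp [hdQ, Pi.single_apply]
    rw [hχ]
    simp only [hd]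
    rw [sum_smul_omitWedge_eq_contractLeft]
    exact contractLeft_ιMulti_basis_mem_and_ne_zero (Pi.basisFun ℝ (Fin (n + 1))) hp
end

section
/- Let m ≥ 2, 1 ≤ a ≤ m, and α₁,…,α_m ∈ ℝ, and set Q(u) = ∏_{j=1}^a (α_j+u) · ∏_{j=a+1}^m (α_j−u). Let u, θ₁,…,θ_m : (−ε,ε) → ℝ be differentiable with θ = θ₁+⋯+θ_m, satisfying α_j + u(t) > 0 for j ≤ a and α_j − u(t) > 0 for j > a for all t, together with du/dt = 2Q(u)^{1/2} cos θ, dθ_j/dt = −Q(u)^{1/2} sin θ/(α_j+u) for j ≤ a, and dθ_j/dt = Q(u)^{1/2} sin θ/(α_j−u) for j > a. Then there exists A ∈ ℝ such that Q(u(t))^{1/2} sin θ(t) = A for all t ∈ (−ε,ε); consequently, for all t ∈ (−ε,ε): (du/dt)² = 4(Q(u(t)) − A²), dθ_j/dt = −A/(α_j+u(t)) for j = 1,…,a, dθ_j/dt = A/(α_j−u(t)) for j = a+1,…,m, and dθ/dt = −A(∑_{j=1}^a 1/(α_j+u(t)) − ∑_{j=a+1}^m 1/(α_j−u(t))). -/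
/-- `Q(v) = ∏_{j=1}^a (α_j + v) · ∏_{j=a+1}^m (α_j − v)`. -/
def quadProd (a : ℕ) {m : ℕ} (α : Fin m → ℝ) (v : ℝ) : ℝ :=
  ∏ j : Fin m, if (j : ℕ) < a then α j + v else α j - v

/-- The logarithmic derivative of `quadProd`, cleared of its denominator. -/
theorem hasDerivAt_quadProd {m : ℕ} (a : ℕ) (α : Fin m → ℝ) (v : ℝ)
    (hv : ∀ j : Fin m, (if (j : ℕ) < a then α j + v else α j - v) ≠ 0) :
    HasDerivAt (quadProd a α)
      (quadProd a α v *
        ∑ j : Fin m, if (j : ℕ) < a then 1 / (α j + v) else -(1 / (α j - v))) v := by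
  have hfactor (j : Fin m) : HasDerivAt (fun w => if (j : ℕ) < a then α j + w else α j - w)
      (if (j : ℕ) < a then 1 else -1) v := by
    split_ifs
    · exact (hasDerivAt_id v).const_add (α j)
    · exact (hasDerivAt_id v).const_sub (α j)
  refine (HasDerivAt.fun_finsetProd (u := Finset.univ) fun j _ => hfactor j).congr_deriv ?_
  rw [Finset.mul_sum]
  refine Finset.sum_congr rfl fun j _ => ?_
  have hj := hv j
  rw [quadProd, ← Finset.prod_erase_mul _ _ (Finset.mem_univ j), smul_eq_mul, mul_assoc]
  congr 1
  split_ifs at hj ⊢ <;> field_simp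

/-- The sum of signed reciprocals splits into its positive and negative parts. -/
theorem sum_ite_lt_one_div {m : ℕ} (a : ℕ) (α : Fin m → ℝ) (v : ℝ) :
    (∑ j : Fin m, if (j : ℕ) < a then 1 / (α j + v) else -(1 / (α j - v))) =
      (∑ j ∈ Finset.univ.filter fun j : Fin m => (j : ℕ) < a, 1 / (α j + v)) -
        ∑ j ∈ Finset.univ.filter fun j : Fin m => a ≤ (j : ℕ), 1 / (α j - v) := by
  simp only [Finset.sum_ite, Finset.sum_neg_distrib, not_lt, sub_eq_add_neg]

/-- For solutions of the angle form of the evolution equations,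
`Q(u)^{1/2} sin θ ≡ A` is constant, and the equations take the first-integral form
`(du/dt)² = 4(Q(u) − A²)`, `dθ_j/dt = ∓A/(α_j ± u)`,
`dθ/dt = −A(∑_{j≤a} 1/(α_j+u) − ∑_{j>a} 1/(α_j−u))`. -/
theorem first_integral_of_quadric_evolution
    (m a : ℕ) (hm : 2 ≤ m) (ha1 : 1 ≤ a) (ham : a ≤ m) (ε : ℝ)
    (α : Fin m → ℝ) (u : ℝ → ℝ) (θ : Fin m → ℝ → ℝ)
    (hpos : ∀ j : Fin m, ∀ t ∈ Set.Ioo (-ε) ε,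
      0 < (if (j : ℕ) < a then α j + u t else α j - u t))
    (hu : ∀ t ∈ Set.Ioo (-ε) ε,
      HasDerivAt u (2 * Real.sqrt (quadProd a α (u t)) * Real.cos (∑ j, θ j t)) t)
    (hθ : ∀ j : Fin m, ∀ t ∈ Set.Ioo (-ε) ε,
      HasDerivAt (θ j)
        (if (j : ℕ) < a then
          -(Real.sqrt (quadProd a α (u t)) * Real.sin (∑ i, θ i t)) / (α j + u t)
        else
          (Real.sqrt (quadProd a α (u t)) * Real.sin (∑ i, θ i t)) / (α j - u t)) t) :
    ∃ A : ℝ, ∀ t ∈ Set.Ioo (-ε) ε,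
      Real.sqrt (quadProd a α (u t)) * Real.sin (∑ j, θ j t) = A ∧
      HasDerivAt u (2 * Real.sqrt (quadProd a α (u t)) * Real.cos (∑ j, θ j t)) t ∧
      (2 * Real.sqrt (quadProd a α (u t)) * Real.cos (∑ j, θ j t)) ^ 2 =
        4 * (quadProd a α (u t) - A ^ 2) ∧
      (∀ j : Fin m, (j : ℕ) < a → HasDerivAt (θ j) (-A / (α j + u t)) t) ∧
      (∀ j : Fin m, a ≤ (j : ℕ) → HasDerivAt (θ j) (A / (α j - u t)) t) ∧
      HasDerivAt (fun s => ∑ j, θ j s)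
        (-A * ((∑ j ∈ Finset.univ.filter fun j : Fin m => (j : ℕ) < a, 1 / (α j + u t)) -
               (∑ j ∈ Finset.univ.filter fun j : Fin m => a ≤ (j : ℕ), 1 / (α j - u t)))) t := by
  have hQ (t : ℝ) (ht : t ∈ Set.Ioo (-ε) ε) : 0 < quadProd a α (u t) :=
    Finset.prod_pos fun j _ => hpos j t ht
  have hθsum (t : ℝ) (ht : t ∈ Set.Ioo (-ε) ε) : HasDerivAt (fun s => ∑ j, θ j s)
      (-(√(quadProd a α (u t)) * Real.sin (∑ j, θ j t)) *
        ∑ j : Fin m, if (j : ℕ) < a then 1 / (α j + u t) else -(1 / (α j - u t))) t := by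
    refine (HasDerivAt.fun_sum (u := Finset.univ) fun j _ => hθ j t ht).congr_deriv ?_
    rw [Finset.mul_sum]
    refine Finset.sum_congr rfl fun j _ => ?_
    split_ifs <;> ring
  have hderiv (t : ℝ) (ht : t ∈ Set.Ioo (-ε) ε) :
      HasDerivAt (fun s => √(quadProd a α (u s)) * Real.sin (∑ j, θ j s)) 0 t := by
    have hsqrt := ((hasDerivAt_quadProd a α (u t) fun j => (hpos j t ht).ne').comp t
      (hu t ht)).sqrt (hQ t ht).ne'
    refine (hsqrt.mul (hθsum t ht).sin).congr_deriv ?_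
    have hne : √(quadProd a α (u t)) ≠ 0 := (Real.sqrt_pos.mpr (hQ t ht)).ne'
    have hsq := Real.sq_sqrt (hQ t ht).le
    simp only [Function.comp_apply]
    field_simp
    rw [hsq]
    ring
  have hconst (t : ℝ) (ht : t ∈ Set.Ioo (-ε) ε) :
      √(quadProd a α (u t)) * Real.sin (∑ j, θ j t) =
        √(quadProd a α (u 0)) * Real.sin (∑ j, θ j 0) := by
    have hε : 0 < ε := by linarith [ht.1, ht.2]
    exact isOpen_Ioo.is_const_of_deriv_eq_zero isPreconnected_Ioo
      (fun s hs => (hderiv s hs).differentiableAt.differentiableWithinAt)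
      (fun s hs => (hderiv s hs).deriv) ht ⟨neg_lt_zero.mpr hε, hε⟩
  refine ⟨_, fun t ht => ⟨hconst t ht, hu t ht, ?_, fun j hj => ?_, fun j hj => ?_, ?_⟩⟩
  · rw [← hconst t ht, mul_pow, mul_pow, mul_pow, Real.sq_sqrt (hQ t ht).le, Real.cos_sq']
    ring
  · simpa only [if_pos hj, hconst t ht] using hθ j t ht
  · simpa only [if_neg hj.not_gt, hconst t ht] using hθ j t ht
  · simpa only [sum_ite_lt_one_div, hconst t ht] using hθsum t ht
end

section
/- Let m ≥ 2, 1 ≤ a ≤ m, α₁,…,α_m ∈ ℝ, and Q(u) = ∏_{j=1}^a (α_j+u) · ∏_{j=a+1}^m (α_j−u). Let u, θ₁,…,θ_m : (−ε,ε) → ℝ be differentiable with θ = θ₁+⋯+θ_m, satisfying α_j + u(t) > 0 for j ≤ a, α_j − u(t) > 0 for j > a, du/dt = 2Q(u)^{1/2} cos θ, dθ_j/dt = −Q(u)^{1/2} sin θ/(α_j+u) for j ≤ a, dθ_j/dt = Q(u)^{1/2} sin θ/(α_j−u) for j > a, and let A ∈ ℝ be the constant with Q(u(t))^{1/2} sin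 θ(t) = A for all t. Suppose in addition that θ(t) ∈ (−π/2, π/2) for all t ∈ (−ε,ε). Then for every t ∈ (−ε,ε): ∫_{u(0)}^{u(t)} dv/(2√(Q(v) − A²)) = t; θ_j(t) = θ_j(0) − (A/2)·∫_{u(0)}^{u(t)} dv/((α_j+v)√(Q(v) − A²)) for j = 1,…,a; and θ_j(t) = θ_j(0) + (A/2)·∫_{u(0)}^{u(t)} dv/((α_j−v)√(Q(v) − A²)) for j = a+1,…,m. -/
/-- Substitution `v = u s` combined with the fundamental theorem of calculus. -/
theorem integral_eq_sub_of_hasDerivAt_comp {u u' F g : ℝ → ℝ} {a b : ℝ}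
    (hu : ∀ s ∈ Set.uIcc a b, HasDerivAt u (u' s) s)
    (hu' : ContinuousOn u' (Set.uIcc a b))
    (hg : ContinuousOn g (u '' Set.uIcc a b))
    (hF : ∀ s ∈ Set.uIcc a b, HasDerivAt F (g (u s) * u' s) s) :
    ∫ v in (u a)..(u b), g v = F b - F a := by
  have hcont : ContinuousOn u (Set.uIcc a b) := fun s hs =>
    (hu s hs).continuousAt.continuousWithinAt
  rw [← intervalIntegral.integral_comp_mul_deriv' hu hu' hg]
  exact intervalIntegral.integral_eq_sub_of_hasDerivAt hF
    ((hg.comp hcont (Set.mapsTo_image u _)).mul hu').intervalIntegrable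

theorem continuous_quadProd (a : ℕ) {m : ℕ} (α : Fin m → ℝ) : Continuous (quadProd a α) := by
  refine continuous_finsetProd _ fun j _ => ?_
  split_ifs <;> fun_prop

open intervalIntegral in
/-- Explicit solution by elliptic integrals: if moreover
`θ(t) ∈ (−π/2, π/2)` throughout, then `t = ∫_{u(0)}^{u(t)} dv/(2√(Q(v) − A²))` and the
angles are given by `θ_j(t) = θ_j(0) ∓ (A/2)·∫_{u(0)}^{u(t)} dv/((α_j ± v)√(Q(v) − A²))`. -/
theorem explicit_solution_by_elliptic_integrals
    (m a : ℕ) (hm : 2 ≤ m) (ha1 : 1 ≤ a) (ham : a ≤ m) (ε : ℝ) (hε : 0 < ε)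
    (α : Fin m → ℝ) (u : ℝ → ℝ) (θ : Fin m → ℝ → ℝ) (A : ℝ)
    (hpos : ∀ j : Fin m, ∀ t ∈ Set.Ioo (-ε) ε,
      0 < (if (j : ℕ) < a then α j + u t else α j - u t))
    (hu : ∀ t ∈ Set.Ioo (-ε) ε,
      HasDerivAt u (2 * Real.sqrt (quadProd a α (u t)) * Real.cos (∑ j, θ j t)) t)
    (hθ : ∀ j : Fin m, ∀ t ∈ Set.Ioo (-ε) ε,
      HasDerivAt (θ j)
        (if (j : ℕ) < a then
          -(Real.sqrt (quadProd a α (u t)) * Real.sin (∑ i, θ i t)) / (α j + u t)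
        else
          (Real.sqrt (quadProd a α (u t)) * Real.sin (∑ i, θ i t)) / (α j - u t)) t)
    (hA : ∀ t ∈ Set.Ioo (-ε) ε,
      Real.sqrt (quadProd a α (u t)) * Real.sin (∑ j, θ j t) = A)
    (hθrange : ∀ t ∈ Set.Ioo (-ε) ε,
      (∑ j, θ j t) ∈ Set.Ioo (-(Real.pi / 2)) (Real.pi / 2)) :
    ∀ t ∈ Set.Ioo (-ε) ε,
      (∫ v in (u 0)..(u t), 1 / (2 * Real.sqrt (quadProd a α v - A ^ 2))) = t ∧
      (∀ j : Fin m, (j : ℕ) < a →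
        θ j t = θ j 0 - (A / 2) *
          ∫ v in (u 0)..(u t),
            1 / ((α j + v) * Real.sqrt (quadProd a α v - A ^ 2))) ∧
      (∀ j : Fin m, a ≤ (j : ℕ) →
        θ j t = θ j 0 + (A / 2) *
          ∫ v in (u 0)..(u t),
            1 / ((α j - v) * Real.sqrt (quadProd a α v - A ^ 2))) := by
  intro t ht
  have hsub : Set.uIcc 0 t ⊆ Set.Ioo (-ε) ε :=
    Set.ordConnected_Ioo.uIcc_subset ⟨by linarith, hε⟩ ht
  have hQ : ∀ s ∈ Set.Ioo (-ε) ε, 0 < quadProd a α (u s) := fun s hs =>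
    Finset.prod_pos fun j _ => hpos j s hs
  have hcos : ∀ s ∈ Set.Ioo (-ε) ε, 0 < Real.cos (∑ j, θ j s) := fun s hs =>
    Real.cos_pos_of_mem_Ioo (hθrange s hs)
  have hsqrt : ∀ s ∈ Set.Ioo (-ε) ε, Real.sqrt (quadProd a α (u s) - A ^ 2) =
      Real.sqrt (quadProd a α (u s)) * Real.cos (∑ j, θ j s) := by
    intro s hs
    rw [← Real.sqrt_sq (mul_nonneg (Real.sqrt_nonneg _) (hcos s hs).le)]
    congr 1
    rw [← hA s hs, mul_pow, mul_pow, Real.sq_sqrt (hQ s hs).le, Real.cos_sq']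
    ring
  have hsqrt_pos : ∀ s ∈ Set.Ioo (-ε) ε, 0 < Real.sqrt (quadProd a α (u s) - A ^ 2) := by
    intro s hs
    rw [hsqrt s hs]
    exact mul_pos (Real.sqrt_pos.2 (hQ s hs)) (hcos s hs)
  have hu' : ∀ s ∈ Set.uIcc 0 t,
      HasDerivAt u (2 * Real.sqrt (quadProd a α (u s) - A ^ 2)) s := by
    intro s hs
    rw [hsqrt s (hsub hs), ← mul_assoc]
    exact hu s (hsub hs)
  have hroot : Continuous fun v => Real.sqrt (quadProd a α v - A ^ 2) :=
    ((continuous_quadProd a α).sub continuous_const).sqrt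
  have hderiv_cont : ContinuousOn (fun s => 2 * Real.sqrt (quadProd a α (u s) - A ^ 2))
      (Set.uIcc 0 t) := fun s hs =>
    (continuousAt_const.mul
      (hroot.continuousAt.comp (hu' s hs).continuousAt)).continuousWithinAt
  refine ⟨?_, fun j hj => ?_, fun j hj => ?_⟩
  · rw [integral_eq_sub_of_hasDerivAt_comp (F := id) hu' hderiv_cont]
    · simp
    · refine continuousOn_const.div (continuous_const.mul hroot).continuousOn ?_
      rintro _ ⟨s, hs, rfl⟩
      exact (mul_pos two_pos (hsqrt_pos s (hsub hs))).ne'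
    · intro s hs
      rw [one_div_mul_cancel (mul_pos two_pos (hsqrt_pos s (hsub hs))).ne']
      exact hasDerivAt_id s
  · have hα : ∀ s ∈ Set.Ioo (-ε) ε, 0 < α j + u s := fun s hs => by
      simpa [hj] using hpos j s hs
    have key := integral_eq_sub_of_hasDerivAt_comp (F := θ j)
      (g := fun v => -(A / 2) * (1 / ((α j + v) * Real.sqrt (quadProd a α v - A ^ 2))))
      hu' hderiv_cont ?_ ?_
    · rw [intervalIntegral.integral_const_mul] at key
      linarith
    · refine continuousOn_const.mul (continuousOn_const.div
        ((continuous_const.add continuous_id).mul hroot).continuousOn ?_)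
      rintro _ ⟨s, hs, rfl⟩
      exact (mul_pos (hα s (hsub hs)) (hsqrt_pos s (hsub hs))).ne'
    · intro s hs
      have h := hθ j s (hsub hs)
      rw [if_pos hj, hA s (hsub hs)] at h
      have h1 := (hα s (hsub hs)).ne'
      have h2 := (hsqrt_pos s (hsub hs)).ne'
      convert h using 1
      field_simp
  · have hj' : ¬ (j : ℕ) < a := not_lt.2 hj
    have hα : ∀ s ∈ Set.Ioo (-ε) ε, 0 < α j - u s := fun s hs => by
      simpa only [if_neg hj'] using hpos j s hs
    have key := integral_eq_sub_of_hasDerivAt_comp (F := θ j)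
      (g := fun v => A / 2 * (1 / ((α j - v) * Real.sqrt (quadProd a α v - A ^ 2))))
      hu' hderiv_cont ?_ ?_
    · rw [intervalIntegral.integral_const_mul] at key
      linarith
    · refine continuousOn_const.mul (continuousOn_const.div
        ((continuous_const.sub continuous_id).mul hroot).continuousOn ?_)
      rintro _ ⟨s, hs, rfl⟩
      exact (mul_pos (hα s (hsub hs)) (hsqrt_pos s (hsub hs))).ne'
    · intro s hs
      have h := hθ j s (hsub hs)
      rw [if_neg hj', hA s (hsub hs)] at h
      have h1 := (hα s (hsub hs)).ne'
      have h2 := (hsqrt_pos s (hsub hs)).ne'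
      convert h using 1
      field_simp
end

section
/- Let m ≥ 2 and 1 ≤ a ≤ m−1, and suppose α₁,…,α_m > 0 satisfy ∑_{j=1}^a 1/α_j = ∑_{j=a+1}^m 1/α_j. Set Q(u) = ∏_{j=1}^a (α_j+u) · ∏_{j=a+1}^m (α_j−u) and θ = θ₁+⋯+θ_m. Let initial values u(0), θ₁(0),…,θ_m(0) ∈ ℝ be given with α_j + u(0) > 0 for j ≤ a, α_j − u(0) > 0 for j > a, and 0 < A < (α₁⋯α_m)^{1/2}, where A = Q(u(0))^{1/2} sin θ(0). Then there exist unique functions u, θ₁,…,θ_m : ℝ → ℝ with these values at t = 0 satisfying, for all t ∈ ℝ, α_j+u(t) > 0 (j ≤ a), α_j−u(t) > 0 (j > a), du/dt = 2Q(u)^{1/2} cos θ, dθ_j/dt = −Q(u)^{1/2} sin θ/(α_j+u) for j ≤ a, and dθ_j/dt = Q(u)^{1/2} sin θ/(α_j−u) for j > a. Furthermore u and θ are nonconstant and periodic with some common period T > 0, and there exist β₁,…,β_m ∈ ℝ with β_j < 0 for j = 1,…,a, β_j > 0 for j = a+1,…,m, and β₁+⋯+β_m = 0, such that θ_j(t+T)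 = θ_j(t) + β_j for all j and all t ∈ ℝ. -/
/-- `u, θ₁, …, θ_m : ℝ → ℝ` is a global solution of the angle form of the quadric
evolution equations: `α_j + u > 0` (`j ≤ a`), `α_j − u > 0` (`j > a`),
`du/dt = 2Q(u)^{1/2} cos θ` and `dθ_j/dt = ∓Q(u)^{1/2} sin θ/(α_j ± u)`,
where `θ = θ₁ + ⋯ + θ_m`. -/
def IsQuadricAngleSolution (m a : ℕ) (α : Fin m → ℝ) (u : ℝ → ℝ)
    (θ : Fin m → ℝ → ℝ) : Prop :=
  (∀ j : Fin m, ∀ t : ℝ, 0 < (if (j : ℕ) < a then α j + u t else α j - u t)) ∧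
  (∀ t : ℝ,
    HasDerivAt u (2 * Real.sqrt (quadProd a α (u t)) * Real.cos (∑ j, θ j t)) t) ∧
  (∀ j : Fin m, ∀ t : ℝ,
    HasDerivAt (θ j)
      (if (j : ℕ) < a then
        -(Real.sqrt (quadProd a α (u t)) * Real.sin (∑ i, θ i t)) / (α j + u t)
      else
        (Real.sqrt (quadProd a α (u t)) * Real.sin (∑ i, θ i t)) / (α j - u t)) t)

section CircleFlow

/-- A positive continuous periodic autonomous field on the line has a global flow line through any
point, which advances by one spatial period in some finite positive time. -/
theorem exists_periodic_flow {f : ℝ → ℝ} {P : ℝ} (hf : Continuous f) (hpos : ∀ x, 0 < f x)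
    (hper : Function.Periodic f P) (hP : 0 < P) (x₀ : ℝ) :
    ∃ T : ℝ, 0 < T ∧ ∃ φ : ℝ → ℝ, φ 0 = x₀ ∧ (∀ t, HasDerivAt φ (f (φ t)) t) ∧
      ∀ t, φ (t + T) = φ t + P := by
  set g : ℝ → ℝ := fun x => (f x)⁻¹
  have hg : Continuous g := hf.inv₀ fun x => (hpos x).ne'
  have hgpos : ∀ x, 0 < g x := fun x => inv_pos.2 (hpos x)
  have hgper : Function.Periodic g P := fun x => by simp only [g, hper x]
  have hint : ∀ s t, IntervalIntegrable g MeasureTheory.volume s t :=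
    fun s t => hg.intervalIntegrable s t
  set F : ℝ → ℝ := fun x => ∫ s in (0 : ℝ)..x, g s
  have hF : ∀ x, HasDerivAt F (g x) x := fun x =>
    intervalIntegral.integral_hasDerivAt_right (hint 0 x)
      (hg.stronglyMeasurableAtFilter _ _) hg.continuousAt
  have hFmono : StrictMono F := strictMono_of_deriv_pos fun x => by
    rw [(hF x).deriv]; exact hgpos x
  have hFcont : Continuous F := continuous_iff_continuousAt.2 fun x => (hF x).continuousAt
  have hFsurj : Function.Surjective F := hFcont.surjective
    (hgper.tendsto_atTop_intervalIntegral_of_pos' (hint 0 P) hgpos hP)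
    (hgper.tendsto_atBot_intervalIntegral_of_pos' (hint 0 P) hgpos hP)
  have hFper : ∀ x, F (x + P) = F x + F P := fun x => by
    simpa [F] using hgper.intervalIntegral_add_eq_add 0 x hint
  let e : ℝ ≃o ℝ := hFmono.orderIsoOfSurjective F hFsurj
  have he : ∀ t, F (e.symm t) = t := e.apply_symm_apply
  have he' : ∀ x, e.symm (F x) = x := e.symm_apply_apply
  refine ⟨F P, ?_, fun t => e.symm (t + F x₀), by simp [he'], fun t => ?_, fun t => ?_⟩
  · simpa [F] using hFmono hP
  · have h := HasDerivAt.of_local_left_inverse (g := e.symm) (a := t + F x₀)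
      e.symm.continuous.continuousAt (hF _) (hgpos _).ne' (Filter.Eventually.of_forall he)
    simpa [g] using h.comp_add_const t (F x₀)
  · apply hFmono.injective
    rw [hFper, he, he]; ring

end CircleFlow

section Oscillator

open Polynomial

theorem Real.exists_cos_sin_eq {a b : ℝ} (h : a ^ 2 + b ^ 2 = 1) :
    ∃ φ : ℝ, Real.cos φ = a ∧ Real.sin φ = b := by
  have hn : ‖(⟨a, b⟩ : ℂ)‖ = 1 := by
    rw [Complex.norm_def, Complex.normSq_mk, ← sq, ← sq, h, Real.sqrt_one]
  refine ⟨Complex.arg ⟨a, b⟩, ?_, ?_⟩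
  · rw [Complex.cos_arg (norm_ne_zero_iff.1 (by rw [hn]; exact one_ne_zero)), hn, div_one]
  · rw [Complex.sin_arg, hn, div_one]

/-- If `p` factors as `(X - x) (y - X) R` with `R > 0` on `[x, y]`, the Hamiltonian system
`u' = 2 w`, `w' = p'(u)` has periodic solutions on the level set `w² = p(u)` over `[x, y]`. -/
theorem exists_periodic_oscillation {x y : ℝ} (hxy : x < y) {p R : ℝ[X]}
    (hp : p = (X - C x) * (C y - X) * R) (hR : ∀ v ∈ Set.Icc x y, 0 < R.eval v)
    {u₀ w₀ : ℝ} (hu₀ : u₀ ∈ Set.Icc x y) (hw₀ : w₀ ^ 2 = p.eval u₀) :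
    ∃ T : ℝ, 0 < T ∧ ∃ u w : ℝ → ℝ, u 0 = u₀ ∧ w 0 = w₀ ∧
      (∀ t, HasDerivAt u (2 * w t) t) ∧ (∀ t, HasDerivAt w (p.derivative.eval (u t)) t) ∧
      (∀ t, u t ∈ Set.Icc x y) ∧ (∀ t, w t ^ 2 = p.eval (u t)) ∧
      Function.Periodic u T ∧ Function.Periodic w T := by
  obtain ⟨c, hc⟩ : ∃ c, c = (x + y) / 2 := ⟨_, rfl⟩
  obtain ⟨r, hr⟩ : ∃ r, r = (y - x) / 2 := ⟨_, rfl⟩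
  obtain rfl : x = c - r := by rw [hc, hr]; ring
  obtain rfl : y = c + r := by linarith
  have hr0 : 0 < r := by linarith
  set U : ℝ → ℝ := fun φ => c + r * Real.sin φ with hU
  have hUmem : ∀ φ, U φ ∈ Set.Icc (c - r) (c + r) := fun φ =>
    ⟨by nlinarith [Real.neg_one_le_sin φ], by nlinarith [Real.sin_le_one φ]⟩
  set S : ℝ → ℝ := fun φ => √(R.eval (U φ)) with hS
  have hRpos : ∀ φ, 0 < R.eval (U φ) := fun φ => hR _ (hUmem φ)
  have hSpos : ∀ φ, 0 < S φ := fun φ => Real.sqrt_pos.2 (hRpos φ)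
  have hSsq : ∀ φ, S φ ^ 2 = R.eval (U φ) := fun φ => Real.sq_sqrt (hRpos φ).le
  have hUper : Function.Periodic U (2 * Real.pi) := fun φ => by simp [hU]
  have hSper : Function.Periodic S (2 * Real.pi) := fun φ => by simp only [hS, hUper φ]
  have hScont : Continuous S := by simp only [hS, hU]; fun_prop
  have hpU : ∀ φ, p.eval (U φ) = (r * Real.cos φ * S φ) ^ 2 := fun φ => by
    rw [mul_pow, hSsq, mul_pow, Real.cos_sq', hp]
    simp only [hU, eval_mul, eval_sub, eval_X, eval_C]; ring
  have hRu₀ : 0 < R.eval u₀ := hR _ hu₀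
  have hp₀ : p.eval u₀ = (r ^ 2 - (u₀ - c) ^ 2) * R.eval u₀ := by
    rw [hp]; simp only [eval_mul, eval_sub, eval_X, eval_C]; ring
  obtain ⟨φ₀, hcos, hsin⟩ := Real.exists_cos_sin_eq
    (a := w₀ / (r * √(R.eval u₀))) (b := (u₀ - c) / r) (by
      rw [div_pow, div_pow, mul_pow, Real.sq_sqrt hRu₀.le, hw₀, hp₀]
      field_simp; ring)
  have hUφ₀ : U φ₀ = u₀ := by
    simp only [hU, hsin]; field_simp; ring
  obtain ⟨T, hT, φ, hφ0, hφ, hφT⟩ := exists_periodic_flow (f := fun φ => 2 * S φ)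
    (by fun_prop) (fun φ => mul_pos two_pos (hSpos φ)) (fun φ => by simp only [hSper φ])
    Real.two_pi_pos φ₀
  have hu : ∀ t, HasDerivAt (fun t => U (φ t)) (2 * (r * Real.cos (φ t) * S (φ t))) t :=
    fun t => (((hφ t).sin.const_mul r).const_add c).congr_deriv (by ring)
  refine ⟨T, hT, fun t => U (φ t), fun t => r * Real.cos (φ t) * S (φ t), ?_, ?_, hu, fun t => ?_,
    fun t => hUmem _, fun t => (hpU _).symm, fun t => ?_, fun t => ?_⟩
  · simp only [hφ0, hUφ₀]
  · simp only [hφ0, hS, hUφ₀, hcos]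
    have := Real.sqrt_pos.2 hRu₀
    field_simp
  · have h0 : HasDerivAt (fun t => R.eval (U (φ t)))
        (R.derivative.eval (U (φ t)) * (2 * (r * Real.cos (φ t) * S (φ t)))) t :=
      (R.hasDerivAt (U (φ t))).comp (h₂ := fun v => R.eval v) t (hu t)
    have h1 := h0.sqrt (hRpos (φ t)).ne'
    refine (((hφ t).cos.const_mul r).mul h1).congr_deriv ?_
    have hS0 := (hSpos (φ t)).ne'
    have hRS := hSsq (φ t)
    have hpd : p.derivative.eval (U (φ t)) = -2 * (r * Real.sin (φ t)) * S (φ t) ^ 2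
        + r ^ 2 * Real.cos (φ t) ^ 2 * R.derivative.eval (U (φ t)) := by
      rw [hRS, Real.cos_sq', hp]
      simp [hU]; ring
    rw [hpd]
    change _ * S (φ t) + _ * (_ / (2 * S (φ t))) = _
    field_simp
  · simp only [hφT, hUper (φ t)]
  · simp only [hφT, hSper (φ t), Real.cos_add_two_pi]

/-- Solutions of `u' = 2 w`, `w' = p'(u)` with `u` confined to a compact interval are determined
by their initial values. -/
theorem oscillation_unique {x y : ℝ} (p : ℝ[X]) {u₁ w₁ u₂ w₂ : ℝ → ℝ}
    (hu₁ : ∀ t, HasDerivAt u₁ (2 * w₁ t) t)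
    (hw₁ : ∀ t, HasDerivAt w₁ (p.derivative.eval (u₁ t)) t) (hm₁ : ∀ t, u₁ t ∈ Set.Icc x y)
    (hu₂ : ∀ t, HasDerivAt u₂ (2 * w₂ t) t)
    (hw₂ : ∀ t, HasDerivAt w₂ (p.derivative.eval (u₂ t)) t) (hm₂ : ∀ t, u₂ t ∈ Set.Icc x y)
    (hu : u₁ 0 = u₂ 0) (hw : w₁ 0 = w₂ 0) : u₁ = u₂ ∧ w₁ = w₂ := by
  obtain ⟨K, hK⟩ := (p.derivative.contDiff_aeval (𝕜 := ℝ) 1).contDiffOn.exists_lipschitzOnWith one_ne_zero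
    (convex_Icc x y) isCompact_Icc
  have hv : LipschitzOnWith (max 2 K)
      (fun z : ℝ × ℝ => ((2 * z.2, p.derivative.eval z.1) : ℝ × ℝ))
      (Set.Icc x y ×ˢ Set.univ) := by
    refine LipschitzOnWith.of_dist_le_mul fun z hz z' hz' => ?_
    have h1 := hK.dist_le_mul _ hz.1 _ hz'.1
    have e1 : dist z.1 z'.1 ≤ dist z z' := le_max_left _ _
    have e2 : dist z.2 z'.2 ≤ dist z z' := le_max_right _ _
    have k1 : (2 : ℝ) ≤ max 2 (K : ℝ) := le_max_left _ _
    have k2 : (K : ℝ) ≤ max 2 (K : ℝ) := le_max_right _ _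
    have h2 : dist (2 * z.2) (2 * z'.2) = 2 * dist z.2 z'.2 := by
      rw [Real.dist_eq, Real.dist_eq, ← mul_sub, abs_mul, abs_two]
    have hk : ((max 2 K : NNReal) : ℝ) = max 2 (K : ℝ) := by push_cast; rfl
    rw [hk, Prod.dist_eq]
    refine max_le ?_ ?_
    · simp only [h2]
      exact mul_le_mul k1 e2 dist_nonneg (by positivity)
    · exact h1.trans (mul_le_mul k2 e1 dist_nonneg (by positivity))
  have h := ODE_solution_unique_univ (t₀ := 0) (f := fun t => (u₁ t, w₁ t))
    (g := fun t => (u₂ t, w₂ t)) (fun _ => hv)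
    (fun t => ⟨(hu₁ t).prodMk (hw₁ t), hm₁ t, trivial⟩)
    (fun t => ⟨(hu₂ t).prodMk (hw₂ t), hm₂ t, trivial⟩) (by simp [hu, hw])
  exact ⟨funext fun t => congrArg Prod.fst (congrFun h t),
    funext fun t => congrArg Prod.snd (congrFun h t)⟩

end Oscillator

section LineProduct

open Polynomial

theorem line_pos_of_mem_Icc {ι : Type*} {α ε : ι → ℝ} {x y v : ℝ} (hx : ∀ j, 0 < α j + ε j * x)
    (hy : ∀ j, 0 < α j + ε j * y) (hv : v ∈ Set.Icc x y) (j : ι) : 0 < α j + ε j * v := by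
  rcases le_total 0 (ε j) with h | h
  · nlinarith [hx j, mul_le_mul_of_nonneg_left hv.1 h]
  · nlinarith [hy j, mul_le_mul_of_nonpos_left hv.2 h]

variable {ι : Type*} [Fintype ι]

/-- The product `∏ j, (α j + ε j * v)` of affine functions of `v`. -/
def lineProd (α ε : ι → ℝ) (v : ℝ) : ℝ :=
  ∏ j, (α j + ε j * v)

/-- The logarithmic derivative of `lineProd`. -/
noncomputable def lineLogDeriv (α ε : ι → ℝ) (v : ℝ) : ℝ :=
  ∑ j, ε j / (α j + ε j * v)

theorem lineProd_neg (α ε : ι → ℝ) (v : ℝ) : lineProd α (-ε) v = lineProd α ε (-v) := by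
  simp [lineProd]

theorem lineProd_pos {α ε : ι → ℝ} {v : ℝ} (hv : ∀ j, 0 < α j + ε j * v) : 0 < lineProd α ε v :=
  Finset.prod_pos fun j _ => hv j

theorem hasDerivAt_lineProd {α ε : ι → ℝ} {v : ℝ} (hv : ∀ j, 0 < α j + ε j * v) :
    HasDerivAt (lineProd α ε) (lineProd α ε v * lineLogDeriv α ε v) v := by
  classical
  have h := HasDerivAt.fun_finsetProd (u := Finset.univ) (f := fun j v => α j + ε j * v)
    (f' := ε) (x := v) fun j _ => by
      simpa using ((hasDerivAt_id v).const_mul (ε j)).const_add (α j)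
  refine h.congr_deriv ?_
  rw [lineLogDeriv, Finset.mul_sum]
  refine Finset.sum_congr rfl fun j _ => ?_
  rw [lineProd, ← Finset.mul_prod_erase _ _ (Finset.mem_univ j), smul_eq_mul]
  have := (hv j).ne'
  rw [mul_right_comm, mul_div_cancel₀ _ this, mul_comm]

theorem lineLogDeriv_lt [Nonempty ι] {α ε : ι → ℝ} (hε : ∀ j, ε j ≠ 0) {v v' : ℝ}
    (hv : ∀ j, 0 < α j + ε j * v) (hv' : ∀ j, 0 < α j + ε j * v') (h : v < v') :
    lineLogDeriv α ε v' < lineLogDeriv α ε v := by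
  refine Finset.sum_lt_sum_of_nonempty Finset.univ_nonempty fun j _ => ?_
  rw [div_lt_div_iff₀ (hv' j) (hv j)]
  nlinarith [mul_pos (sq_pos_of_ne_zero (hε j)) (sub_pos.2 h)]

theorem strictMonoOn_lineProd [Nonempty ι] {α ε : ι → ℝ} (hα : ∀ j, 0 < α j)
    (hε : ∀ j, ε j ≠ 0) (hbal : lineLogDeriv α ε 0 = 0) {x : ℝ}
    (hx : ∀ j, 0 < α j + ε j * x) : StrictMonoOn (lineProd α ε) (Set.Icc x 0) := by
  have h0 : ∀ j, 0 < α j + ε j * 0 := by simpa using hα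
  have hD : ∀ v ∈ Set.Icc x 0, ∀ j, 0 < α j + ε j * v := fun v hv => line_pos_of_mem_Icc hx h0 hv
  refine strictMonoOn_of_deriv_pos (convex_Icc _ _)
    (fun v hv => (hasDerivAt_lineProd (hD v hv)).continuousAt.continuousWithinAt) fun v hv => ?_
  rw [interior_Icc] at hv
  have hv' := hD v (Set.Ioo_subset_Icc_self hv)
  rw [(hasDerivAt_lineProd hv').deriv]
  exact mul_pos (lineProd_pos hv') (hbal ▸ lineLogDeriv_lt hε hv' h0 hv.2)

/-- A positive level below the maximum is attained to the left of the maximum. -/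
theorem exists_neg_lineProd_eq [Nonempty ι] {α ε : ι → ℝ} (hα : ∀ j, 0 < α j)
    (hε : ∀ j, ε j ≠ 0) (hbal : lineLogDeriv α ε 0 = 0) (hex : ∃ j, 0 < ε j) {B : ℝ}
    (hB : 0 < B) (hB' : B < lineProd α ε 0) :
    ∃ x < 0, (∀ j, 0 < α j + ε j * x) ∧ lineProd α ε x = B ∧
      (∀ v, x < v → v ≤ 0 → B < lineProd α ε v) ∧
      ∀ v, (∀ j, 0 < α j + ε j * v) → B ≤ lineProd α ε v → x ≤ v := by
  obtain ⟨k, hk, hkmin⟩ := Finset.exists_min_image (Finset.univ.filter fun j => 0 < ε j)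
    (fun j => α j / ε j) (by simpa [Finset.filter_nonempty_iff] using hex)
  replace hk : 0 < ε k := by simpa using hk
  have hz : -(α k / ε k) < 0 := neg_neg_of_pos (div_pos (hα k) hk)
  have hD : ∀ v, -(α k / ε k) < v → v ≤ 0 → ∀ j, 0 < α j + ε j * v := fun v hv hv0 j => by
    rcases (hε j).lt_or_gt with h | h
    · nlinarith [hα j, mul_nonneg_of_nonpos_of_nonpos h.le hv0]
    · have h1 : α k / ε k ≤ α j / ε j := hkmin j (by simpa using h)
      have h2 : ε j * (α j / ε j) = α j := mul_div_cancel₀ _ h.ne'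
      nlinarith [mul_pos h (show 0 < α j / ε j + v by linarith)]
  have hQz : lineProd α ε (-(α k / ε k)) = 0 :=
    Finset.prod_eq_zero (Finset.mem_univ k) (by field_simp; ring)
  have hcont : Continuous (lineProd α ε) := by unfold lineProd; fun_prop
  obtain ⟨x, ⟨hx1, hx2⟩, hxB⟩ := intermediate_value_Ioo hz.le hcont.continuousOn
    (show B ∈ Set.Ioo _ _ from ⟨hQz ▸ hB, hB'⟩)
  have hDx := hD x hx1 hx2.le
  refine ⟨x, hx2, hDx, hxB, fun v hv hv0 => ?_, fun v hv hBv => ?_⟩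
  · rw [← hxB]
    exact strictMonoOn_lineProd hα hε hbal hDx ⟨le_rfl, hx2.le⟩ ⟨hv.le, hv0⟩ hv
  · by_contra! hlt
    have := strictMonoOn_lineProd hα hε hbal hv ⟨le_rfl, (hlt.trans hx2).le⟩ ⟨hlt.le, hx2.le⟩ hlt
    linarith

/-- A positive level below the maximum is attained to the right of the maximum. -/
theorem exists_pos_lineProd_eq [Nonempty ι] {α ε : ι → ℝ} (hα : ∀ j, 0 < α j)
    (hε : ∀ j, ε j ≠ 0) (hbal : lineLogDeriv α ε 0 = 0) (hex : ∃ j, ε j < 0) {B : ℝ}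
    (hB : 0 < B) (hB' : B < lineProd α ε 0) :
    ∃ y, 0 < y ∧ (∀ j, 0 < α j + ε j * y) ∧ lineProd α ε y = B ∧
      (∀ v, 0 ≤ v → v < y → B < lineProd α ε v) ∧
      ∀ v, (∀ j, 0 < α j + ε j * v) → B ≤ lineProd α ε v → v ≤ y := by
  obtain ⟨x, hx, hDx, hxB, hgt, hle⟩ := exists_neg_lineProd_eq (α := α) (ε := -ε) hα
    (by simpa using hε) (by simpa [lineLogDeriv, neg_div] using hbal) (by simpa using hex) hB
    (by simpa [lineProd_neg] using hB')
  refine ⟨-x, by linarith, by simpa using hDx, by rw [← lineProd_neg, hxB], fun v h0 hv => ?_,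
    fun v hv hBv => ?_⟩
  · simpa [lineProd_neg] using hgt (-v) (by linarith) (by linarith)
  · have := hle (-v) (by simpa using hv) (by simpa [lineProd_neg] using hBv)
    linarith

/-- A polynomial that is positive between two simple zeros `x < y` is the product of
`(X - x) (y - X)` and a polynomial that is positive on all of `[x, y]`. -/
theorem exists_factor_pos {p : ℝ[X]} {x y : ℝ} (hxy : x < y) (hx : p.eval x = 0)
    (hy : p.eval y = 0) (hx' : 0 < p.derivative.eval x) (hy' : p.derivative.eval y < 0)
    (hpos : ∀ v ∈ Set.Ioo x y, 0 < p.eval v) :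
    ∃ R : ℝ[X], p = (X - C x) * (C y - X) * R ∧ ∀ v ∈ Set.Icc x y, 0 < R.eval v := by
  obtain ⟨R, hR⟩ : (X - C x) * (X - C y) ∣ p :=
    (isCoprime_X_sub_C_of_isUnit_sub (sub_ne_zero.2 hxy.ne).isUnit).mul_dvd
      (dvd_iff_isRoot.2 hx) (dvd_iff_isRoot.2 hy)
  have hp : p = (X - C x) * (C y - X) * -R := by rw [hR]; ring
  refine ⟨-R, hp, fun v hv => ?_⟩
  generalize -R = R at hp
  rcases hv.1.eq_or_lt with rfl | h1
  · rw [hp] at hx'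
    have : 0 < (y - x) * R.eval x := by simpa using hx'
    exact pos_of_mul_pos_right this (by linarith)
  rcases hv.2.eq_or_lt with rfl | h2
  · rw [hp] at hy'
    have : (x - v) * R.eval v < 0 := by simpa using hy'
    replace this : 0 < (v - x) * R.eval v := by linarith
    exact pos_of_mul_pos_right this (by linarith)
  · have := hpos v ⟨h1, h2⟩
    rw [hp] at this
    simp only [eval_mul, eval_sub, eval_X, eval_C] at this
    exact pos_of_mul_pos_right this (mul_nonneg (by linarith) (by linarith))

/-- Below its maximum `lineProd - B` is a potential well with nondegenerate turning points. -/
theorem exists_lineProd_well [Nonempty ι] {α ε : ι → ℝ} (hα : ∀ j, 0 < α j)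
    (hε : ∀ j, ε j ≠ 0) (hbal : lineLogDeriv α ε 0 = 0) (hpos : ∃ j, 0 < ε j)
    (hneg : ∃ j, ε j < 0) {B : ℝ} (hB : 0 < B) (hB' : B < lineProd α ε 0) :
    ∃ (x y : ℝ) (p R : ℝ[X]), x < y ∧ (∀ v ∈ Set.Icc x y, ∀ j, 0 < α j + ε j * v) ∧
      (∀ v, (∀ j, 0 < α j + ε j * v) → B ≤ lineProd α ε v → v ∈ Set.Icc x y) ∧
      (∀ v, p.eval v = lineProd α ε v - B) ∧
      (∀ v, (∀ j, 0 < α j + ε j * v) →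
        p.derivative.eval v = lineProd α ε v * lineLogDeriv α ε v) ∧
      p = (X - C x) * (C y - X) * R ∧ ∀ v ∈ Set.Icc x y, 0 < R.eval v := by
  obtain ⟨x, hx, hDx, hxB, hxgt, hxle⟩ := exists_neg_lineProd_eq hα hε hbal hpos hB hB'
  obtain ⟨y, hy, hDy, hyB, hygt, hyle⟩ := exists_pos_lineProd_eq hα hε hbal hneg hB hB'
  have h0 : ∀ j, 0 < α j + ε j * 0 := by simpa using hα
  obtain ⟨p, hp⟩ : ∃ p : ℝ[X], ∀ v, p.eval v = lineProd α ε v - B :=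
    ⟨(∏ j, (C (α j) + C (ε j) * X)) - C B, fun v => by simp [lineProd, eval_prod]⟩
  have hp' : ∀ v, (∀ j, 0 < α j + ε j * v) →
      p.derivative.eval v = lineProd α ε v * lineLogDeriv α ε v := fun v hv => by
    have h := (hasDerivAt_lineProd hv).sub_const B
    exact (p.hasDerivAt v).unique (h.congr_of_eventuallyEq (Filter.Eventually.of_forall hp))
  obtain ⟨R, hR, hRpos⟩ := exists_factor_pos (p := p) (hx.trans hy) (by rw [hp, hxB, sub_self])
    (by rw [hp, hyB, sub_self])
    (by rw [hp' x hDx]; exact mul_pos (lineProd_pos hDx) (hbal ▸ lineLogDeriv_lt hε hDx h0 hx))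
    (by
      rw [hp' y hDy]
      exact mul_neg_of_pos_of_neg (lineProd_pos hDy) (hbal ▸ lineLogDeriv_lt hε h0 hDy hy))
    (fun v hv => by
      rw [hp, sub_pos]
      rcases le_total v 0 with h | h
      · exact hxgt v hv.1 h
      · exact hygt v h hv.2)
  exact ⟨x, y, p, R, hx.trans hy, fun v hv => line_pos_of_mem_Icc hDx hDy hv,
    fun v hv hBv => ⟨hxle v hv hBv, hyle v hv hBv⟩, hp, hp', hR, hRpos⟩

end LineProduct

section AngleSolution

variable {ι : Type*} [Fintype ι]

/-- The angle form of the evolution equations for the affine factors `α j + ε j * u`. -/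
def IsLineAngleSolution (α ε : ι → ℝ) (u : ℝ → ℝ) (θ : ι → ℝ → ℝ) : Prop :=
  (∀ j t, 0 < α j + ε j * u t) ∧
  (∀ t, HasDerivAt u (2 * √(lineProd α ε (u t)) * Real.cos (∑ j, θ j t)) t) ∧
  ∀ j t, HasDerivAt (θ j)
    (-(ε j * (√(lineProd α ε (u t)) * Real.sin (∑ i, θ i t))) / (α j + ε j * u t)) t

namespace IsLineAngleSolution

variable {α ε : ι → ℝ} {u : ℝ → ℝ} {θ : ι → ℝ → ℝ}

theorem hasDerivAt_sum (h : IsLineAngleSolution α ε u θ) (t : ℝ) :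
    HasDerivAt (fun t => ∑ j, θ j t)
      (-(√(lineProd α ε (u t)) * Real.sin (∑ i, θ i t)) * lineLogDeriv α ε (u t)) t := by
  refine (HasDerivAt.fun_sum fun j _ => h.2.2 j t).congr_deriv ?_
  rw [lineLogDeriv, Finset.mul_sum]
  exact Finset.sum_congr rfl fun j _ => by ring

theorem hasDerivAt_sqrt (h : IsLineAngleSolution α ε u θ) (t : ℝ) :
    HasDerivAt (fun t => √(lineProd α ε (u t)))
      (lineProd α ε (u t) * lineLogDeriv α ε (u t) * Real.cos (∑ j, θ j t)) t := by
  have hQ := lineProd_pos fun j => h.1 j t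
  have h0 : HasDerivAt (fun t => lineProd α ε (u t)) _ t :=
    (hasDerivAt_lineProd fun j => h.1 j t).comp (h₂ := lineProd α ε) t (h.2.1 t)
  refine (h0.sqrt hQ.ne').congr_deriv ?_
  have := (Real.sqrt_pos.2 hQ).ne'
  field_simp

theorem hasDerivAt_sqrt_mul_cos (h : IsLineAngleSolution α ε u θ) (t : ℝ) :
    HasDerivAt (fun t => √(lineProd α ε (u t)) * Real.cos (∑ j, θ j t))
      (lineProd α ε (u t) * lineLogDeriv α ε (u t)) t := by
  refine ((h.hasDerivAt_sqrt t).mul (h.hasDerivAt_sum t).cos).congr_deriv ?_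
  have hs := Real.sq_sqrt (lineProd_pos fun j => h.1 j t).le
  have hc := Real.sin_sq_add_cos_sq (∑ j, θ j t)
  linear_combination (lineLogDeriv α ε (u t) * Real.sin (∑ j, θ j t) ^ 2) * hs +
    lineProd α ε (u t) * lineLogDeriv α ε (u t) * hc

/-- `Q(u)^{1/2} sin θ` is a first integral. -/
theorem sqrt_mul_sin_eq (h : IsLineAngleSolution α ε u θ) (t : ℝ) :
    √(lineProd α ε (u t)) * Real.sin (∑ j, θ j t) =
      √(lineProd α ε (u 0)) * Real.sin (∑ j, θ j 0) := by
  have hd : ∀ t, HasDerivAt (fun t => √(lineProd α ε (u t)) * Real.sin (∑ j, θ j t)) 0 t :=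
    fun t => by
      refine ((h.hasDerivAt_sqrt t).mul (h.hasDerivAt_sum t).sin).congr_deriv ?_
      have hs := Real.sq_sqrt (lineProd_pos fun j => h.1 j t).le
      linear_combination
        (-lineLogDeriv α ε (u t) * Real.sin (∑ j, θ j t) * Real.cos (∑ j, θ j t)) * hs
  exact is_const_of_deriv_eq_zero (fun t => (hd t).differentiableAt) (fun t => (hd t).deriv) t 0

theorem sq_sqrt_mul_cos (h : IsLineAngleSolution α ε u θ) (t : ℝ) :
    (√(lineProd α ε (u t)) * Real.cos (∑ j, θ j t)) ^ 2 =
      lineProd α ε (u t) - (√(lineProd α ε (u 0)) * Real.sin (∑ j, θ j 0)) ^ 2 := by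
  rw [← h.sqrt_mul_sin_eq t, mul_pow, mul_pow, Real.cos_sq',
    Real.sq_sqrt (lineProd_pos fun j => h.1 j t).le]
  ring

end IsLineAngleSolution

/-- Solutions of the angle equations are recovered from periodic solutions of the Hamiltonian
system `u' = 2 w`, `w' = Q'(u)` on the level set `w² = Q(u) - A²`. -/
theorem exists_lineAngleSolution {α ε : ι → ℝ} {u w : ℝ → ℝ} {A T : ℝ} (hA : 0 < A) (hT : 0 < T)
    (hD : ∀ j t, 0 < α j + ε j * u t) (hu : ∀ t, HasDerivAt u (2 * w t) t)
    (hw : ∀ t, HasDerivAt w (lineProd α ε (u t) * lineLogDeriv α ε (u t)) t)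
    (hAw : ∀ t, w t ^ 2 = lineProd α ε (u t) - A ^ 2)
    (huT : Function.Periodic u T) (hwT : Function.Periodic w T) {θ₀ : ι → ℝ}
    (hsin : √(lineProd α ε (u 0)) * Real.sin (∑ j, θ₀ j) = A)
    (hcos : √(lineProd α ε (u 0)) * Real.cos (∑ j, θ₀ j) = w 0) :
    ∃ θ : ι → ℝ → ℝ, (∀ j, θ j 0 = θ₀ j) ∧ IsLineAngleSolution α ε u θ ∧
      Function.Periodic (fun t => ∑ j, θ j t) T ∧
      ∃ β : ι → ℝ, (∀ j, 0 < ε j → β j < 0) ∧ (∀ j, ε j < 0 → 0 < β j) ∧ ∑ j, β j = 0 ∧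
        ∀ j t, θ j (t + T) = θ j t + β j := by
  have hucont : Continuous u := continuous_iff_continuousAt.2 fun t => (hu t).continuousAt
  have hQ : ∀ t, lineProd α ε (u t) = A ^ 2 + w t ^ 2 := fun t => by rw [hAw]; ring
  set g : ι → ℝ → ℝ := fun j t => -(ε j * A) / (α j + ε j * u t) with hg
  have hgcont : ∀ j, Continuous (g j) := fun j =>
    Continuous.div (by fun_prop) (by fun_prop) fun t => (hD j t).ne'
  have hgint : ∀ j s t, IntervalIntegrable (g j) MeasureTheory.volume s t :=
    fun j s t => (hgcont j).intervalIntegrable s t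
  have hgper : ∀ j, Function.Periodic (g j) T := fun j t => by simp only [hg, huT t]
  set θ : ι → ℝ → ℝ := fun j t => θ₀ j + ∫ s in (0 : ℝ)..t, g j s with hθ
  have hθ' : ∀ j t, HasDerivAt (θ j) (g j t) t := fun j t =>
    (intervalIntegral.integral_hasDerivAt_right (hgint j 0 t)
      ((hgcont j).stronglyMeasurableAtFilter _ _) (hgcont j).continuousAt).const_add _
  have hθ0 : ∀ j, θ j 0 = θ₀ j := fun j => by simp [hθ]
  have hsum : ∀ t, HasDerivAt (fun t => ∑ j, θ j t) (-(A * lineLogDeriv α ε (u t))) t := fun t => by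
    refine (HasDerivAt.fun_sum fun j _ => hθ' j t).congr_deriv ?_
    rw [lineLogDeriv, ← neg_mul, Finset.mul_sum]
    exact Finset.sum_congr rfl fun j _ => by ring
  have hsumeq : ∀ t, ∑ j, θ j t =
      ∑ j, θ₀ j + Real.arctan (w 0 / A) - Real.arctan (w t / A) := fun t => by
    have hd : ∀ t, HasDerivAt (fun t => ∑ j, θ j t + Real.arctan (w t / A)) 0 t := fun t => by
      refine ((hsum t).add ((hw t).div_const A).arctan).congr_deriv ?_
      have : A ^ 2 + w t ^ 2 ≠ 0 := by positivity
      rw [hQ]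
      field_simp
      ring
    have h := is_const_of_deriv_eq_zero (fun t => (hd t).differentiableAt)
      (fun t => (hd t).deriv) t 0
    simp only [hθ0] at h
    linarith
  have hQsqrt : ∀ t, √(1 + (w t / A) ^ 2) = √(lineProd α ε (u t)) / A := fun t => by
    rw [hQ, show 1 + (w t / A) ^ 2 = (A ^ 2 + w t ^ 2) / A ^ 2 by field_simp,
      Real.sqrt_div (by positivity), Real.sqrt_sq hA.le]
  have hsqrt : ∀ t, 0 < √(lineProd α ε (u t)) := fun t =>
    Real.sqrt_pos.2 (lineProd_pos fun j => hD j t)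
  have hcosw : ∀ t, Real.cos (Real.arctan (w t / A)) = A / √(lineProd α ε (u t)) := fun t => by
    rw [Real.cos_arctan, hQsqrt, one_div_div]
  have hsinw : ∀ t, Real.sin (Real.arctan (w t / A)) = w t / √(lineProd α ε (u t)) := fun t => by
    rw [Real.sin_arctan, hQsqrt]
    field_simp
  have hsq0 : √(lineProd α ε (u 0)) ^ 2 = A ^ 2 + w 0 ^ 2 := by
    rw [Real.sq_sqrt (lineProd_pos fun j => hD j 0).le, hQ]
  have hs0 := (hsqrt 0).ne'
  have hsin0 : Real.sin (∑ j, θ₀ j) = A / √(lineProd α ε (u 0)) := by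
    rw [← hsin]; field_simp
  have hcos0 : Real.cos (∑ j, θ₀ j) = w 0 / √(lineProd α ε (u 0)) := by
    rw [← hcos]; field_simp
  have hsinC : Real.sin (∑ j, θ₀ j + Real.arctan (w 0 / A)) = 1 := by
    rw [Real.sin_add, hcosw, hsinw, hsin0, hcos0]
    field_simp
    rw [hsq0]
  have hcosC : Real.cos (∑ j, θ₀ j + Real.arctan (w 0 / A)) = 0 := by
    rw [Real.cos_add, hcosw, hsinw, hsin0, hcos0]
    ring
  have hsint : ∀ t, √(lineProd α ε (u t)) * Real.sin (∑ j, θ j t) = A := fun t => by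
    have := (hsqrt t).ne'
    rw [hsumeq, Real.sin_sub, hsinC, hcosC, hcosw]
    field_simp
    ring
  have hcost : ∀ t, √(lineProd α ε (u t)) * Real.cos (∑ j, θ j t) = w t := fun t => by
    have := (hsqrt t).ne'
    rw [hsumeq, Real.cos_sub, hsinC, hcosC, hsinw]
    field_simp
    ring
  have hper : Function.Periodic (fun t => ∑ j, θ j t) T := fun t => by
    simp only [hsumeq, hwT t]
  have hadd : ∀ j t, θ j (t + T) = θ j t + ∫ s in (0 : ℝ)..T, g j s := fun j t => by
    have := (hgper j).intervalIntegral_add_eq_add 0 t (hgint j)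
    simp only [hθ, this, zero_add, add_assoc]
  refine ⟨θ, hθ0, ⟨hD, fun t => ?_, fun j t => ?_⟩, hper, fun j => ∫ s in (0 : ℝ)..T, g j s,
    fun j hj => ?_, fun j hj => ?_, ?_, hadd⟩
  · rw [mul_assoc, hcost]; exact hu t
  · rw [hsint]; exact hθ' j t
  · rw [← neg_pos, ← intervalIntegral.integral_neg]
    refine intervalIntegral.intervalIntegral_pos_of_pos (hgint j 0 T).neg (fun t => ?_) hT
    rw [← neg_div, neg_neg]
    exact div_pos (mul_pos hj hA) (hD j t)
  · exact intervalIntegral.intervalIntegral_pos_of_pos (hgint j 0 T)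
      (fun t => div_pos (neg_pos.2 (mul_neg_of_neg_of_pos hj hA)) (hD j t)) hT
  · have h := hper 0
    simp only [hadd, Finset.sum_add_distrib] at h
    linarith

/-- In the balanced case with first integral strictly between `0` and its maximum, the angle
equations have unique global solutions, and these are nonconstant and periodic up to a shift of
the angles. -/
theorem lineAngleSolution_periodic [Nonempty ι] {α ε : ι → ℝ} (hα : ∀ j, 0 < α j)
    (hε : ∀ j, ε j ≠ 0) (hbal : lineLogDeriv α ε 0 = 0) (hpos : ∃ j, 0 < ε j)
    (hneg : ∃ j, ε j < 0) {u₀ : ℝ} {θ₀ : ι → ℝ} (hu₀ : ∀ j, 0 < α j + ε j * u₀) {A : ℝ}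
    (hA : A = √(lineProd α ε u₀) * Real.sin (∑ j, θ₀ j)) (hA0 : 0 < A)
    (hA1 : A < √(lineProd α ε 0)) :
    ∃ (u : ℝ → ℝ) (θ : ι → ℝ → ℝ),
      u 0 = u₀ ∧ (∀ j, θ j 0 = θ₀ j) ∧ IsLineAngleSolution α ε u θ ∧
      (∀ (u' : ℝ → ℝ) (θ' : ι → ℝ → ℝ),
        u' 0 = u₀ → (∀ j, θ' j 0 = θ₀ j) → IsLineAngleSolution α ε u' θ' → u' = u ∧ θ' = θ) ∧
      ∃ T : ℝ, 0 < T ∧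
        Function.Periodic u T ∧ Function.Periodic (fun t => ∑ j, θ j t) T ∧
        (¬ ∃ c : ℝ, ∀ t, u t = c) ∧ (¬ ∃ c : ℝ, ∀ t, (∑ j, θ j t) = c) ∧
        ∃ β : ι → ℝ, (∀ j, 0 < ε j → β j < 0) ∧ (∀ j, ε j < 0 → 0 < β j) ∧ ∑ j, β j = 0 ∧
          ∀ j t, θ j (t + T) = θ j t + β j := by
  have hAQ : A ^ 2 < lineProd α ε 0 := (Real.lt_sqrt hA0.le).1 hA1
  obtain ⟨x, y, p, R, hxy, hD, hmem, hp, hp', hR, hRpos⟩ :=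
    exists_lineProd_well hα hε hbal hpos hneg (pow_pos hA0 2) hAQ
  have hw₀ : (√(lineProd α ε u₀) * Real.cos (∑ j, θ₀ j)) ^ 2 = lineProd α ε u₀ - A ^ 2 := by
    rw [hA, mul_pow, mul_pow, Real.cos_sq', Real.sq_sqrt (lineProd_pos hu₀).le]
    ring
  obtain ⟨T, hT, u, w, hu0, hw0, hu, hw, hum, hwp, huT, hwT⟩ :=
    exists_periodic_oscillation hxy hR hRpos (hmem u₀ hu₀ (sub_nonneg.1 (hw₀ ▸ sq_nonneg _)))
      (hw₀.trans (hp u₀).symm)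
  have hDu : ∀ j t, 0 < α j + ε j * u t := fun j t => hD _ (hum t) j
  have hAw : ∀ t, w t ^ 2 = lineProd α ε (u t) - A ^ 2 := fun t => (hwp t).trans (hp _)
  have hw' : ∀ t, HasDerivAt w (lineProd α ε (u t) * lineLogDeriv α ε (u t)) t := fun t =>
    hp' (u t) (fun j => hDu j t) ▸ hw t
  obtain ⟨θ, hθ0, hsol, hθT, β, hβneg, hβpos, hβ, hθβ⟩ := exists_lineAngleSolution hA0 hT hDu hu
    hw' hAw huT hwT (θ₀ := θ₀) (by rw [hu0, hA]) (by rw [hu0, hw0])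
  have hnot : ¬ ∀ t, lineLogDeriv α ε (u t) = 0 := fun hL => by
    have hz : ∀ t, u t = 0 := fun t => by
      by_contra hne
      rcases lt_or_gt_of_ne hne with h | h
      · exact (lineLogDeriv_lt hε (fun j => hDu j t) (by simpa using hα) h).ne'
          ((hL t).trans hbal.symm)
      · exact (lineLogDeriv_lt hε (by simpa using hα) (fun j => hDu j t) h).ne
          ((hL t).trans hbal.symm)
    have h2 : 2 * w 0 = 0 := (hu 0).unique ((funext hz : u = fun _ => 0) ▸ hasDerivAt_const _ _)
    have h3 := hAw 0
    rw [hz, show w 0 = 0 by linarith] at h3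
    linarith
  refine ⟨u, θ, hu0, hθ0, hsol, fun u' θ' hu0' hθ0' hsol' => ?_, T, hT, huT, hθT, ?_, ?_,
    β, hβneg, hβpos, hβ, hθβ⟩
  · have hsq := hsol'.sq_sqrt_mul_cos
    simp only [hu0', hθ0', ← hA] at hsq
    obtain ⟨rfl, -⟩ := oscillation_unique p (u₁ := u')
      (w₁ := fun t => √(lineProd α ε (u' t)) * Real.cos (∑ j, θ' j t))
      (fun t => by rw [← mul_assoc]; exact hsol'.2.1 t)
      (fun t => hp' (u' t) (fun j => hsol'.1 j t) ▸ hsol'.hasDerivAt_sqrt_mul_cos t)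
      (fun t => hmem _ (fun j => hsol'.1 j t) (sub_nonneg.1 (hsq t ▸ sq_nonneg _)))
      hu hw hum (hu0'.trans hu0.symm) (by simp only [hu0', hθ0', hw0])
    refine ⟨rfl, funext fun j => ?_⟩
    have hd : ∀ t, HasDerivAt (fun t => θ' j t - θ j t) 0 t := fun t => by
      refine ((hsol'.2.2 j t).sub (hsol.2.2 j t)).congr_deriv ?_
      rw [hsol'.sqrt_mul_sin_eq, hsol.sqrt_mul_sin_eq]
      simp only [hθ0, hθ0', sub_self]
    funext t
    have h := is_const_of_deriv_eq_zero (fun t => (hd t).differentiableAt)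
      (fun t => (hd t).deriv) t 0
    simp only [hθ0, hθ0', sub_self] at h
    exact sub_eq_zero.1 h
  · rintro ⟨c, hc⟩
    have hw0 : ∀ t, w t = 0 := fun t => by
      have h2 : 2 * w t = 0 := (hu t).unique ((funext hc : u = fun _ => c) ▸ hasDerivAt_const _ _)
      linarith
    refine hnot fun t => ?_
    have h := (hw' t).unique ((funext hw0 : w = fun _ => 0) ▸ hasDerivAt_const _ _)
    exact (mul_eq_zero.1 h).resolve_left (lineProd_pos fun j => hDu j t).ne'
  · rintro ⟨c, hc⟩
    refine hnot fun t => ?_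
    have h := (hsol.hasDerivAt_sum t).unique
      ((funext hc : (fun t => ∑ j, θ j t) = fun _ => c) ▸ hasDerivAt_const _ _)
    rw [hsol.sqrt_mul_sin_eq] at h
    simp only [hu0, hθ0, ← hA] at h
    exact (mul_eq_zero.1 h).resolve_left (neg_ne_zero.2 hA0.ne')

end AngleSolution

section QuadricSigns

/-- The signs in the factors of `quadProd`. -/
def quadricSign (a : ℕ) {m : ℕ} (j : Fin m) : ℝ :=
  if (j : ℕ) < a then 1 else -1

theorem quadricFactor_eq (a : ℕ) {m : ℕ} (α : Fin m → ℝ) (v : ℝ) (j : Fin m) :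
    (if (j : ℕ) < a then α j + v else α j - v) = α j + quadricSign a j * v := by
  unfold quadricSign; split_ifs <;> ring

theorem quadProd_eq_lineProd (a : ℕ) {m : ℕ} (α : Fin m → ℝ) (v : ℝ) :
    quadProd a α v = lineProd α (quadricSign a) v :=
  Finset.prod_congr rfl fun j _ => quadricFactor_eq a α v j

theorem isQuadricAngleSolution_iff {m a : ℕ} {α : Fin m → ℝ} {u : ℝ → ℝ} {θ : Fin m → ℝ → ℝ} :
    IsQuadricAngleSolution m a α u θ ↔ IsLineAngleSolution α (quadricSign a) u θ := by
  have h : ∀ (j : Fin m) (t b : ℝ),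
      (if (j : ℕ) < a then -b / (α j + u t) else b / (α j - u t)) =
        -(quadricSign a j * b) / (α j + quadricSign a j * u t) := fun j t b => by
    unfold quadricSign; split_ifs <;> simp [sub_eq_add_neg]
  simp only [IsQuadricAngleSolution, IsLineAngleSolution, quadricFactor_eq, quadProd_eq_lineProd, h]

end QuadricSigns

/-- In case (d), with `0 < A < (α₁⋯α_m)^{1/2}`, solutions of the angle
equations exist for all time, are unique given their initial values, and `u`, `θ` are
nonconstant and periodic with a common period `T > 0`; moreover each `θ_j` increases by a
constant `β_j` over one period, with `β_j < 0` for `j ≤ a`, `β_j > 0` for `j > a`, and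
`β₁ + ⋯ + β_m = 0`. -/
theorem global_periodic_solutions_case_d
    (m a : ℕ) (hm : 2 ≤ m) (ha1 : 1 ≤ a) (ham : a ≤ m - 1)
    (α : Fin m → ℝ) (hα : ∀ j, 0 < α j)
    (hbal : (∑ j ∈ Finset.univ.filter fun j : Fin m => (j : ℕ) < a, 1 / α j) =
            (∑ j ∈ Finset.univ.filter fun j : Fin m => a ≤ (j : ℕ), 1 / α j))
    (u₀ : ℝ) (θ₀ : Fin m → ℝ)
    (hpos₀ : ∀ j : Fin m, 0 < (if (j : ℕ) < a then α j + u₀ else α j - u₀))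
    (A : ℝ) (hAdef : A = Real.sqrt (quadProd a α u₀) * Real.sin (∑ j, θ₀ j))
    (hA0 : 0 < A) (hA1 : A < Real.sqrt (∏ j, α j)) :
    ∃ (u : ℝ → ℝ) (θ : Fin m → ℝ → ℝ),
      u 0 = u₀ ∧ (∀ j, θ j 0 = θ₀ j) ∧ IsQuadricAngleSolution m a α u θ ∧
      (∀ (u' : ℝ → ℝ) (θ' : Fin m → ℝ → ℝ),
        u' 0 = u₀ → (∀ j, θ' j 0 = θ₀ j) → IsQuadricAngleSolution m a α u' θ' →
        u' = u ∧ θ' = θ) ∧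
      ∃ T : ℝ, 0 < T ∧
        Function.Periodic u T ∧ Function.Periodic (fun t => ∑ j, θ j t) T ∧
        (¬ ∃ c : ℝ, ∀ t, u t = c) ∧ (¬ ∃ c : ℝ, ∀ t, (∑ j, θ j t) = c) ∧
        ∃ β : Fin m → ℝ,
          (∀ j : Fin m, (j : ℕ) < a → β j < 0) ∧
          (∀ j : Fin m, a ≤ (j : ℕ) → 0 < β j) ∧
          (∑ j, β j = 0) ∧
          ∀ (j : Fin m) (t : ℝ), θ j (t + T) = θ j t + β j := by
  have hsign_pos : ∀ j : Fin m, 0 < quadricSign a j ↔ (j : ℕ) < a := fun j => by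
    unfold quadricSign; split_ifs with h <;> simp [h]
  have hsign_neg : ∀ j : Fin m, quadricSign a j < 0 ↔ a ≤ (j : ℕ) := fun j => by
    unfold quadricSign; split_ifs with h
    · exact iff_of_false (by norm_num) h.not_ge
    · exact iff_of_true (by norm_num) (not_lt.1 h)
  have hbal' : lineLogDeriv α (quadricSign a) 0 = 0 := by
    have h : ∀ j : Fin m, quadricSign a j / (α j + quadricSign a j * 0) =
        (if (j : ℕ) < a then 1 / α j else 0) - (if a ≤ (j : ℕ) then 1 / α j else 0) := fun j => by
      unfold quadricSign
      rcases lt_or_ge (j : ℕ) a with h | h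
      · simp [h, h.not_ge]
      · simp [h, h.not_gt, neg_div]
    rw [lineLogDeriv, Finset.sum_congr rfl fun j _ => h j, Finset.sum_sub_distrib,
      ← Finset.sum_filter, ← Finset.sum_filter, hbal, sub_self]
  have : Nonempty (Fin m) := ⟨⟨0, by omega⟩⟩
  have hmain := lineAngleSolution_periodic (ε := quadricSign a) hα
    (fun j => by unfold quadricSign; split_ifs <;> norm_num) hbal'
    ⟨⟨0, by omega⟩, (hsign_pos _).2 ha1⟩ ⟨⟨m - 1, by omega⟩, (hsign_neg _).2 ham⟩
    (fun j => by simpa only [quadricFactor_eq] using hpos₀ j)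
    (by rw [hAdef, quadProd_eq_lineProd]) hA0 (by simpa [lineProd] using hA1)
  simpa only [hsign_pos, hsign_neg, ← isQuadricAngleSolution_iff] using hmain
end

section
/- Let m ≥ 2 and 1 ≤ a ≤ m−1, and suppose α₁,…,α_m > 0 satisfy ∑_{j=1}^a 1/α_j = ∑_{j=a+1}^m 1/α_j, ordered so that α₁ = ⋯ = α_k < α_j for k < j ≤ a (k being the multiplicity of the minimum among α₁,…,α_a), and α_{m−l+1} = ⋯ = α_m < α_j for a < j ≤ m−l (l being the multiplicity of the minimum among α_{a+1},…,α_m). Set Q(u) = ∏_{j=1}^a (α_j+u) · ∏_{j=a+1}^m (α_j−u). For 0 < A < (α₁⋯α_m)^{1/2}, let γ = γ(A) be the unique solution of Q(γ) = A² in (−α₁, 0) and δ = δ(A) the unique solution of Q(δ) = A² in (0, α_m), and define β_j(A) = −∫_γ^δ dv/((α_j+v)·√(A^{−2}Q(v) − 1)) for j = 1,…,a and β_j(A) = ∫_γ^δ dv/((α_j−v)·√(A^{−2}Q(v) − 1)) for j = a+1,…,m. Then, holding α₁,…,α_m fixed: as A → 0⁺, β_j(A) → −π/k for 1 ≤ j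 ≤ k, β_j(A) → 0 for k < j ≤ m−l, and β_j(A) → π/l for m−l < j ≤ m; and as A → (α₁⋯α_m)^{1/2} from below, β_j(A) → −2π·α_j^{−1}·(2∑_{i=1}^m α_i^{−2})^{−1/2} for 1 ≤ j ≤ a and β_j(A) → 2π·α_j^{−1}·(2∑_{i=1}^m α_i^{−2})^{−1/2} for a+1 ≤ j ≤ m. -/
section

open Filter intervalIntegral MeasureTheory Topology Real

/-- If `w * k` is the derivative of `Φ` and `f` is within `η * w` of `L * w`, then `f * k` is
integrable and its integral is close to `L` times the increment of `Φ`. -/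
theorem abs_integral_mul_sub_le_of_hasDerivAt {Φ w k f : ℝ → ℝ} {x y L η : ℝ} (hxy : x ≤ y)
    (hΦ : ContinuousOn Φ (Set.Icc x y))
    (hd : ∀ v ∈ Set.Ioo x y, HasDerivAt Φ (w v * k v) v)
    (hw : ∀ v ∈ Set.Ioo x y, 0 ≤ w v) (hk : ∀ v ∈ Set.Ioo x y, 0 ≤ k v)
    (hf : ∀ v ∈ Set.Ioo x y, |f v - L * w v| ≤ η * w v)
    (hc : ContinuousOn (fun v => f v * k v) (Set.Ioo x y)) :
    IntervalIntegrable (fun v => f v * k v) volume x y ∧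
      |(∫ v in x..y, f v * k v) - L * (Φ y - Φ x)| ≤ η * (Φ y - Φ x) := by
  have hwk : IntervalIntegrable (fun v => w v * k v) volume x y := by
    rw [intervalIntegrable_iff_integrableOn_Ioc_of_le hxy]
    exact integrableOn_deriv_of_nonneg hΦ hd fun v hv => mul_nonneg (hw v hv) (hk v hv)
  have hint : ∫ v in x..y, w v * k v = Φ y - Φ x :=
    integral_eq_sub_of_hasDerivAt_of_le hxy hΦ hd hwk
  have hbound : ∀ v ∈ Set.Ioo x y, |f v * k v - L * (w v * k v)| ≤ η * (w v * k v) := by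
    intro v hv
    rw [show f v * k v - L * (w v * k v) = (f v - L * w v) * k v by ring, abs_mul,
      abs_of_nonneg (hk v hv), ← mul_assoc]
    exact mul_le_mul_of_nonneg_right (hf v hv) (hk v hv)
  have hfk : IntervalIntegrable (fun v => f v * k v) volume x y := by
    rw [intervalIntegrable_iff_integrableOn_Ioo_of_le hxy] at hwk ⊢
    refine Integrable.mono' (hwk.const_mul (η + |L|))
      (hc.aestronglyMeasurable measurableSet_Ioo) ?_
    filter_upwards [ae_restrict_mem measurableSet_Ioo] with v hv
    have h1 := hbound v hv
    have h2 : |L * (w v * k v)| = |L| * (w v * k v) := by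
      rw [abs_mul, abs_of_nonneg (mul_nonneg (hw v hv) (hk v hv))]
    have h3 := abs_sub_abs_le_abs_sub (f v * k v) (L * (w v * k v))
    rw [Real.norm_eq_abs]
    linarith
  refine ⟨hfk, ?_⟩
  rw [← hint, ← intervalIntegral.integral_const_mul, ← intervalIntegral.integral_sub hfk
    (hwk.const_mul L), ← intervalIntegral.integral_const_mul, ← Real.norm_eq_abs]
  refine intervalIntegral.norm_integral_le_of_norm_le hxy ?_ (hwk.const_mul η)
  have : ∀ᵐ v : ℝ, v ≠ y := by simp [ae_iff]
  filter_upwards [this] with v hvy hv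
  exact hbound v ⟨hv.1, lt_of_le_of_ne hv.2 hvy⟩

/-- A positive function `q` on `[0, b)` with logarithmic derivative `-v * R v`, `R` positive and
continuous; in particular `q` is strictly decreasing. -/
structure IsBump (q R : ℝ → ℝ) (b : ℝ) : Prop where
  hasDerivAt : ∀ v ∈ Set.Ico 0 b, HasDerivAt q (-(q v * (v * R v))) v
  pos : ∀ v ∈ Set.Ico 0 b, 0 < q v
  continuousOn : ContinuousOn R (Set.Ico 0 b)
  slope_pos : ∀ v ∈ Set.Ico 0 b, 0 < R v

namespace IsBump

variable {q R f : ℝ → ℝ} {b : ℝ}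

theorem continuousOn_self (h : IsBump q R b) : ContinuousOn q (Set.Ico 0 b) :=
  fun v hv => (h.hasDerivAt v hv).continuousAt.continuousWithinAt

theorem strictAntiOn (h : IsBump q R b) : StrictAntiOn q (Set.Ico 0 b) := by
  refine strictAntiOn_of_hasDerivWithinAt_neg (f' := fun v => -(q v * (v * R v)))
    (convex_Ico 0 b) h.continuousOn_self
    (fun v hv => (h.hasDerivAt v (interior_subset hv)).hasDerivWithinAt) ?_
  intro v hv
  rw [interior_Ico] at hv
  have hv' := Set.Ioo_subset_Ico_self hv
  have := mul_pos (h.pos v hv') (mul_pos hv.1 (h.slope_pos v hv'))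
  linarith

theorem continuousOn_kernel (h : IsBump q R b) (hf : ContinuousOn f (Set.Ico 0 b)) {A d : ℝ}
    (hA : 0 < A) (hd : d ∈ Set.Ioo 0 b) (hqd : q d = A ^ 2) :
    ContinuousOn (fun v => f v * (1 / √(q v / A ^ 2 - 1))) (Set.Ico 0 d) := by
  have hsub : Set.Ico 0 d ⊆ Set.Ico 0 b := Set.Ico_subset_Ico_right hd.2.le
  refine (hf.mono hsub).mul (continuousOn_const.div
    (((h.continuousOn_self.mono hsub).div_const _).sub continuousOn_const).sqrt ?_)
  intro v hv
  have := h.strictAntiOn (hsub hv) ⟨hd.1.le, hd.2⟩ hv.2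
  rw [hqd] at this
  refine (Real.sqrt_pos.2 ?_).ne'
  rw [sub_pos, one_lt_div (by positivity)]
  exact this

theorem near_end (h : IsBump q R b) (hf : ContinuousOn f (Set.Ico 0 b)) {A d c L η : ℝ}
    (hA : 0 < A) (hd : d ∈ Set.Ioo 0 b) (hqd : q d = A ^ 2) (hc : c ∈ Set.Ioo 0 d)
    (hL : ∀ v ∈ Set.Ioo c d, |f v - L * (v * R v)| ≤ η * (v * R v)) :
    IntervalIntegrable (fun v => f v * (1 / √(q v / A ^ 2 - 1))) volume c d ∧
      |(∫ v in c..d, f v * (1 / √(q v / A ^ 2 - 1))) -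
        L * (2 * arctan √(q c / A ^ 2 - 1))| ≤ η * (2 * arctan √(q c / A ^ 2 - 1)) := by
  have hA2 : 0 < A ^ 2 := by positivity
  have hsub : Set.Icc c d ⊆ Set.Ico 0 b := fun v hv => ⟨hc.1.le.trans hv.1, hv.2.trans_lt hd.2⟩
  have hgt : ∀ v ∈ Set.Ioo c d, 0 < q v / A ^ 2 - 1 := by
    intro v hv
    have := h.strictAntiOn (hsub (Set.Ioo_subset_Icc_self hv)) ⟨hd.1.le, hd.2⟩ hv.2
    rw [hqd] at this
    rw [sub_pos, one_lt_div hA2]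
    exact this
  have key := abs_integral_mul_sub_le_of_hasDerivAt
    (Φ := fun v => -(2 * arctan √(q v / A ^ 2 - 1))) (w := fun v => v * R v)
    (k := fun v => 1 / √(q v / A ^ 2 - 1)) (f := f) (L := L) (η := η) hc.2.le
    ?_ ?_ ?_ ?_ hL ?_
  · have hz : q d / A ^ 2 - 1 = 0 := by rw [hqd, div_self hA2.ne', sub_self]
    simpa [hz] using key
  · exact ((continuous_arctan.comp_continuousOn
      (((h.continuousOn_self.mono hsub).div_const _).sub continuousOn_const).sqrt).const_smul
      (2 : ℝ)).neg
  · intro v hv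
    have hv0 := hgt v hv
    have hqv := h.pos v (hsub (Set.Ioo_subset_Icc_self hv))
    have := (((((h.hasDerivAt v (hsub (Set.Ioo_subset_Icc_self hv))).div_const (A ^ 2)).sub_const
      1).sqrt hv0.ne').arctan.const_mul 2).neg
    refine HasDerivAt.congr_deriv this (Eq.symm ?_)
    rw [Real.sq_sqrt hv0.le, add_sub_cancel]
    have hr := (Real.sqrt_pos.2 hv0).ne'
    generalize √(q v / A ^ 2 - 1) = r at hr ⊢
    field_simp
  · intro v hv
    exact mul_nonneg (hc.1.le.trans hv.1.le)
      (h.slope_pos v (hsub (Set.Ioo_subset_Icc_self hv))).le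
  · intro v hv
    positivity
  · exact (h.continuousOn_kernel hf hA hd hqd).mono
      fun v hv => ⟨(hc.1.trans hv.1).le, hv.2⟩

theorem intervalIntegrable_kernel (h : IsBump q R b) (hf : ContinuousOn f (Set.Ico 0 b))
    {A d : ℝ} (hA : 0 < A) (hd : d ∈ Set.Ioo 0 b) (hqd : q d = A ^ 2) :
    IntervalIntegrable (fun v => f v * (1 / √(q v / A ^ 2 - 1))) volume 0 d := by
  have hc : d / 2 ∈ Set.Ioo 0 d := ⟨half_pos hd.1, half_lt_self hd.1⟩
  have h1 : IntervalIntegrable (fun v => f v * (1 / √(q v / A ^ 2 - 1))) volume 0 (d / 2) := by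
    refine ((h.continuousOn_kernel hf hA hd hqd).mono ?_).intervalIntegrable
    rw [Set.uIcc_of_le hc.1.le]
    exact Set.Icc_subset_Ico_right hc.2
  have hsub : Set.Icc (d / 2) d ⊆ Set.Ico 0 b :=
    fun v hv => ⟨hc.1.le.trans hv.1, hv.2.trans_lt hd.2⟩
  have hGpos : ∀ v ∈ Set.Icc (d / 2) d, 0 < v * R v := fun v hv =>
    mul_pos (hc.1.trans_le hv.1) (h.slope_pos v (hsub hv))
  obtain ⟨η, hη⟩ := isCompact_Icc.exists_bound_of_continuousOn
    (f := fun v => f v / (v * R v)) (s := Set.Icc (d / 2) d)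
    ((hf.mono hsub).div (continuousOn_id.mul (h.continuousOn.mono hsub))
      fun v hv => (hGpos v hv).ne')
  refine h1.trans (h.near_end (L := 0) (η := η) hf hA hd hqd hc ?_).1
  intro v hv
  have hv' := Set.Ioo_subset_Icc_self hv
  have := hη v hv'
  rw [norm_div, Real.norm_eq_abs, Real.norm_eq_abs, abs_of_pos (hGpos v hv'),
    div_le_iff₀ (hGpos v hv')] at this
  simpa using this

theorem lt_of_apply_lt (h : IsBump q R b) {c d : ℝ} (hc : c ∈ Set.Ico 0 b) (hd : d ∈ Set.Ico 0 b)
    (hlt : q d < q c) : c < d :=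
  (h.strictAntiOn.lt_iff_gt hd hc).1 hlt

/-- As the level `A ^ 2` tends to `0`, the integral only sees the behaviour of `f` at `b`. -/
theorem tendsto_integral_zero (h : IsBump q R b) (hb : 0 < b) (hf : ContinuousOn f (Set.Ico 0 b))
    {L : ℝ} (hL : Tendsto (fun v => f v / (v * R v)) (𝓝[<] b) (𝓝 L)) {δ : ℝ → ℝ}
    (hδ : ∀ A ∈ Set.Ioo 0 √(q 0), δ A ∈ Set.Ioo 0 b ∧ q (δ A) = A ^ 2) :
    Tendsto (fun A => ∫ v in 0..δ A, f v * (1 / √(q v / A ^ 2 - 1))) (𝓝[>] 0)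
      (𝓝 (L * π)) := by
  have hq0 : 0 < q 0 := h.pos 0 ⟨le_rfl, hb⟩
  rw [Metric.tendsto_nhds]
  intro ε hε
  obtain ⟨η, hη, hηε⟩ : ∃ η > 0, η * π < ε :=
    ⟨ε / 2 / π, by positivity, by field_simp; linarith⟩
  have hev : ∀ᶠ v in 𝓝[<] b, v ∈ Set.Ioo 0 b ∧ |f v / (v * R v) - L| < η :=
    Filter.Eventually.and (Ioo_mem_nhdsLT hb) ((Metric.tendsto_nhds.1 hL) η hη)
  obtain ⟨c, hcb, hcL⟩ : ∃ c ∈ Set.Ioo 0 b, ∀ v ∈ Set.Ioo c b, |f v / (v * R v) - L| < η := by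
    obtain ⟨c, hc, hcs⟩ := (mem_nhdsLT_iff_exists_Ioo_subset' hb).1 hev
    refine ⟨max c (b / 2), ⟨lt_max_of_lt_right (half_pos hb), max_lt hc (half_lt_self hb)⟩, ?_⟩
    intro v hv
    exact (hcs ⟨(le_max_left _ _).trans_lt hv.1, hv.2⟩).2
  have hcb' := Set.Ioo_subset_Ico_self hcb
  have hqc : 0 < q c := h.pos c hcb'
  have hcsub : Set.Icc 0 c ⊆ Set.Ico 0 b := Set.Icc_subset_Ico_right hcb.2
  obtain ⟨M, hM⟩ := isCompact_Icc.exists_bound_of_continuousOn (hf.mono hcsub)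
  have hT : Tendsto (fun A : ℝ => √(q c / A ^ 2 - 1)) (𝓝[>] 0) atTop := by
    refine Real.tendsto_sqrt_atTop.comp (tendsto_atTop_add_const_right _ (-1) ?_)
    refine Tendsto.const_mul_atTop hqc (tendsto_inv_nhdsGT_zero.comp ?_)
    refine tendsto_nhdsWithin_iff.2 ⟨?_, ?_⟩
    · have : Tendsto (fun A : ℝ => A ^ 2) (𝓝 0) (𝓝 (0 ^ 2)) := (continuous_pow 2).tendsto 0
      rw [zero_pow two_ne_zero] at this
      exact this.mono_left nhdsWithin_le_nhds
    · filter_upwards [self_mem_nhdsWithin] with A hA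
      exact pow_pos (Set.mem_Ioi.1 hA) 2
  have hT1 : Tendsto (fun A : ℝ => 2 * arctan √(q c / A ^ 2 - 1)) (𝓝[>] 0) (𝓝 π) := by
    have := ((tendsto_arctan_atTop.mono_right nhdsWithin_le_nhds).comp hT).const_mul 2
    rwa [mul_div_cancel₀ _ (two_ne_zero)] at this
  have hT2 : Tendsto (fun A : ℝ => M * (1 / √(q c / A ^ 2 - 1)) * c) (𝓝[>] 0) (𝓝 0) := by
    have := ((hT.inv_tendsto_atTop).const_mul M).mul_const c
    simpa using this
  have hT3 : Tendsto (fun A : ℝ => M * (1 / √(q c / A ^ 2 - 1)) * c +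
      η * (2 * arctan √(q c / A ^ 2 - 1)) + |L * (2 * arctan √(q c / A ^ 2 - 1)) - L * π|)
      (𝓝[>] 0) (𝓝 (η * π)) := by
    have := (hT2.add (hT1.const_mul η)).add (((hT1.const_mul L).sub_const (L * π)).abs)
    simpa using this
  filter_upwards [hT3.eventually (gt_mem_nhds hηε),
    Ioo_mem_nhdsGT (Real.sqrt_pos.2 hq0), Ioo_mem_nhdsGT (Real.sqrt_pos.2 hqc)] with A h3 hA hAc
  obtain ⟨hd, hqd⟩ := hδ A hA
  have hA0 : 0 < A := hA.1
  have hlt : A ^ 2 < q c := (Real.lt_sqrt hA0.le).1 hAc.2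
  have hcd : c < δ A := h.lt_of_apply_lt hcb' (Set.Ioo_subset_Ico_self hd) (by rwa [hqd])
  have hI := h.intervalIntegrable_kernel hf hA0 hd hqd
  have hsplit := intervalIntegral.integral_add_adjacent_intervals
    (hI.mono_set (c := 0) (d := c) (by
      rw [Set.uIcc_of_le hcb.1.le, Set.uIcc_of_le hd.1.le]; exact Set.Icc_subset_Icc_right hcd.le))
    (hI.mono_set (c := c) (d := δ A) (by
      rw [Set.uIcc_of_le hcd.le, Set.uIcc_of_le hd.1.le]
      exact Set.Icc_subset_Icc_left hcb.1.le))
  have hend := (h.near_end (L := L) (η := η) hf hA0 hd hqd ⟨hcb.1, hcd⟩ (by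
    intro v hv
    have hvb : v ∈ Set.Ioo c b := ⟨hv.1, hv.2.trans hd.2⟩
    have hG : 0 < v * R v :=
      mul_pos (hcb.1.trans hv.1) (h.slope_pos v ⟨(hcb.1.trans hv.1).le, hvb.2⟩)
    have := (hcL v hvb).le
    rw [show f v - L * (v * R v) = (f v / (v * R v) - L) * (v * R v) by
      rw [sub_mul, div_mul_cancel₀ _ hG.ne'], abs_mul,
      abs_of_pos hG]
    exact mul_le_mul_of_nonneg_right this hG.le)).2
  have hstart : ‖∫ v in 0..c, f v * (1 / √(q v / A ^ 2 - 1))‖ ≤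
      M * (1 / √(q c / A ^ 2 - 1)) * |c - 0| := by
    refine intervalIntegral.norm_integral_le_of_norm_le_const fun v hv => ?_
    rw [Set.uIoc_of_le hcb.1.le] at hv
    have hv' := Set.Ioc_subset_Icc_self hv
    have hqv : q c ≤ q v := h.strictAntiOn.antitoneOn (hcsub hv') hcb' hv.2
    rw [norm_mul, Real.norm_of_nonneg (by positivity : 0 ≤ 1 / √(q v / A ^ 2 - 1))]
    have hpos : 0 < q c / A ^ 2 - 1 := by
      rw [sub_pos, one_lt_div (by positivity)]
      exact hlt
    refine mul_le_mul (hM v hv') ?_ (by positivity) ((norm_nonneg _).trans (hM v hv'))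
    exact one_div_le_one_div_of_le (Real.sqrt_pos.2 hpos) (Real.sqrt_le_sqrt (by gcongr))
  rw [Real.norm_eq_abs, sub_zero, abs_of_pos hcb.1] at hstart
  rw [Real.dist_eq, ← hsplit]
  refine lt_of_le_of_lt ?_ h3
  set I1 := ∫ v in 0..c, f v * (1 / √(q v / A ^ 2 - 1))
  set I2 := ∫ v in c..δ A, f v * (1 / √(q v / A ^ 2 - 1))
  set T := L * (2 * arctan √(q c / A ^ 2 - 1))
  calc |I1 + I2 - L * π| = |I1 + (I2 - T) + (T - L * π)| := by ring_nf
    _ ≤ |I1| + |I2 - T| + |T - L * π| := abs_add_three _ _ _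
    _ ≤ _ := by gcongr

theorem near_start (h : IsBump q R b) (hf : ContinuousOn f (Set.Ico 0 b)) {A d L η : ℝ}
    (hA : 0 < A) (hd : d ∈ Set.Ioo 0 b) (hqd : q d = A ^ 2)
    (hL : ∀ v ∈ Set.Ioo 0 d, |f v - L * (q v * (v * R v) / (2 * √(q 0 - q v)))| ≤
      η * (q v * (v * R v) / (2 * √(q 0 - q v)))) :
    |(∫ v in 0..d, f v * (1 / √(q v / A ^ 2 - 1))) - L * (A * (π / 2))| ≤
      η * (A * (π / 2)) := by
  have hA2 : 0 < A ^ 2 := by positivity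
  have h0 : (0 : ℝ) ∈ Set.Ico 0 b := ⟨le_rfl, hd.1.trans hd.2⟩
  have hdb : d ∈ Set.Ico 0 b := Set.Ioo_subset_Ico_self hd
  have hsub : Set.Icc 0 d ⊆ Set.Ico 0 b := Set.Icc_subset_Ico_right hd.2
  have hD : 0 < q 0 - A ^ 2 := by
    rw [← hqd]; exact sub_pos.2 (h.strictAntiOn h0 hdb hd.1)
  have hgt : ∀ v ∈ Set.Ioo 0 d, A ^ 2 < q v := fun v hv => by
    rw [← hqd]; exact h.strictAntiOn (hsub (Set.Ioo_subset_Icc_self hv)) hdb hv.2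
  have hlt : ∀ v ∈ Set.Ioo 0 d, q v < q 0 := fun v hv =>
    h.strictAntiOn h0 (hsub (Set.Ioo_subset_Icc_self hv)) hv.1
  have key := abs_integral_mul_sub_le_of_hasDerivAt
    (Φ := fun v => A * arcsin √((q 0 - q v) / (q 0 - A ^ 2)))
    (w := fun v => q v * (v * R v) / (2 * √(q 0 - q v)))
    (k := fun v => 1 / √(q v / A ^ 2 - 1)) (f := f) (L := L) (η := η) hd.1.le
    ?_ ?_ ?_ ?_ hL ?_
  · simpa [hqd, div_self hD.ne'] using key.2
  · exact (continuous_arcsin.comp_continuousOn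
      ((continuousOn_const.sub (h.continuousOn_self.mono hsub)).div_const _).sqrt).const_smul A
  · intro v hv
    have hqA := sub_pos.2 (hgt v hv)
    have hq0 := sub_pos.2 (hlt v hv)
    have hx0 : 0 < (q 0 - q v) / (q 0 - A ^ 2) := by positivity
    have hx1 : (q 0 - q v) / (q 0 - A ^ 2) < 1 := by
      rw [div_lt_one hD]; linarith
    have hs0 := Real.sqrt_nonneg ((q 0 - q v) / (q 0 - A ^ 2))
    have hs1 : √((q 0 - q v) / (q 0 - A ^ 2)) < 1 := by
      rwa [Real.sqrt_lt' one_pos, one_pow]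
    have := (((Real.hasDerivAt_arcsin (by linarith) hs1.ne).comp v
      ((((h.hasDerivAt v (hsub (Set.Ioo_subset_Icc_self hv))).const_sub (q 0)).div_const
        (q 0 - A ^ 2)).sqrt hx0.ne')).const_mul A)
    refine HasDerivAt.congr_deriv this (Eq.symm ?_)
    rw [Real.sq_sqrt hx0.le, show 1 - (q 0 - q v) / (q 0 - A ^ 2) =
      (q v - A ^ 2) / (q 0 - A ^ 2) by field_simp; ring, show q v / A ^ 2 - 1 =
      (q v - A ^ 2) / A ^ 2 by field_simp, Real.sqrt_div' _ hD.le, Real.sqrt_div' _ hD.le,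
      Real.sqrt_div' _ hA2.le, Real.sqrt_sq hA.le]
    have h1 := (Real.sqrt_pos.2 hqA).ne'
    have h2 := (Real.sqrt_pos.2 hq0).ne'
    have h3 := (Real.sqrt_pos.2 hD).ne'
    have h4 := Real.sq_sqrt hD.le
    field_simp
    rw [h4]
  · intro v hv
    have hv' := hsub (Set.Ioo_subset_Icc_self hv)
    have := h.pos v hv'
    have := h.slope_pos v hv'
    have := hv.1
    positivity
  · intro v hv
    positivity
  · exact (h.continuousOn_kernel hf hA hd hqd).mono Set.Ioo_subset_Ico_self

theorem tendsto_weight (h : IsBump q R b) (hb : 0 < b) :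
    Tendsto (fun v => q v * (v * R v) / (2 * √(q 0 - q v))) (𝓝[>] 0) (𝓝 √(q 0 * R 0 / 2)) := by
  have h0 : (0 : ℝ) ∈ Set.Ico 0 b := ⟨le_rfl, hb⟩
  have hq0 := h.pos 0 h0
  have hR0 := h.slope_pos 0 h0
  have hle : 𝓝[>] (0 : ℝ) ≤ 𝓝[Set.Ico 0 b] 0 := by
    rw [← nhdsWithin_Ioo_eq_nhdsGT hb]
    exact nhdsWithin_mono _ Set.Ioo_subset_Ico_self
  have hqt : Tendsto q (𝓝[>] 0) (𝓝 (q 0)) := (h.continuousOn_self 0 h0).mono_left hle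
  have hRt : Tendsto R (𝓝[>] 0) (𝓝 (R 0)) := (h.continuousOn 0 h0).mono_left hle
  have hquot : Tendsto (fun v => (q 0 - q v) / v ^ 2) (𝓝[>] 0) (𝓝 (q 0 * R 0 / 2)) := by
    refine HasDerivAt.lhopital_zero_right_on_Ioo (f' := fun v => q v * (v * R v))
      (g' := fun v => 2 * v) hb ?_ ?_ ?_ ?_ ?_ ?_
    · intro v hv
      simpa using (h.hasDerivAt v (Set.Ioo_subset_Ico_self hv)).const_sub (q 0)
    · intro v hv
      simpa using hasDerivAt_pow 2 v
    · intro v hv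
      exact mul_ne_zero two_ne_zero hv.1.ne'
    · simpa using hqt.const_sub (q 0)
    · have : Tendsto (fun v : ℝ => v ^ 2) (𝓝 0) (𝓝 (0 ^ 2)) := (continuous_pow 2).tendsto 0
      rw [zero_pow two_ne_zero] at this
      exact this.mono_left nhdsWithin_le_nhds
    · refine ((hqt.mul hRt).div_const 2).congr' ?_
      filter_upwards [self_mem_nhdsWithin] with v hv
      have : v ≠ 0 := (Set.mem_Ioi.1 hv).ne'
      field_simp
  have hpos : 0 < q 0 * R 0 / 2 := by positivity
  have := (hqt.mul hRt).div (hquot.sqrt.const_mul 2)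
    (mul_ne_zero two_ne_zero (Real.sqrt_pos.2 hpos).ne')
  have hval : q 0 * R 0 / (2 * √(q 0 * R 0 / 2)) = √(q 0 * R 0 / 2) := by
    rw [div_eq_iff (by positivity)]
    nlinarith [Real.mul_self_sqrt hpos.le]
  rw [hval] at this
  refine this.congr' ?_
  filter_upwards [Ioo_mem_nhdsGT hb] with v hv
  have hv0 := hv.1
  have hs : 0 < √(q 0 - q v) := Real.sqrt_pos.2
    (sub_pos.2 (h.strictAntiOn h0 (Set.Ioo_subset_Ico_self hv) hv.1))
  simp only [Pi.div_apply]
  rw [Real.sqrt_div' _ (by positivity), Real.sqrt_sq hv0.le]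
  field_simp

/-- As the level `A ^ 2` tends to the maximum `q 0`, the integral only sees `f 0` and the second
derivative of `q` at `0`. -/
theorem tendsto_integral_max (h : IsBump q R b) (hb : 0 < b) (hf : ContinuousOn f (Set.Ico 0 b))
    {δ : ℝ → ℝ} (hδ : ∀ A ∈ Set.Ioo 0 √(q 0), δ A ∈ Set.Ioo 0 b ∧ q (δ A) = A ^ 2) :
    Tendsto (fun A => ∫ v in 0..δ A, f v * (1 / √(q v / A ^ 2 - 1))) (𝓝[<] √(q 0))
      (𝓝 (f 0 * (π / √(2 * R 0)))) := by
  have h0 : (0 : ℝ) ∈ Set.Ico 0 b := ⟨le_rfl, hb⟩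
  have hq0 := h.pos 0 h0
  have hR0 := h.slope_pos 0 h0
  have hsq : 0 < √(q 0) := Real.sqrt_pos.2 hq0
  have hW : 0 < √(q 0 * R 0 / 2) := by positivity
  set L := f 0 / √(q 0 * R 0 / 2) with hLdef
  have hlim : f 0 * (π / √(2 * R 0)) = L * (√(q 0) * (π / 2)) := by
    rw [hLdef, show q 0 * R 0 / 2 = q 0 * (2 * R 0) / 2 ^ 2 by ring, Real.sqrt_div' _ (by positivity),
      Real.sqrt_mul hq0.le, Real.sqrt_sq two_pos.le]
    field_simp
  have hft : Tendsto f (𝓝[>] 0) (𝓝 (f 0)) := by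
    refine (hf 0 h0).mono_left ?_
    rw [← nhdsWithin_Ioo_eq_nhdsGT hb]
    exact nhdsWithin_mono _ Set.Ioo_subset_Ico_self
  have hL := hft.div (h.tendsto_weight hb) hW.ne'
  rw [hlim, Metric.tendsto_nhds]
  intro ε hε
  obtain ⟨η, hη, hηε⟩ : ∃ η > 0, η * (√(q 0) * (π / 2)) < ε :=
    ⟨ε / 2 / (√(q 0) * (π / 2)), by positivity, by
      rw [div_mul_cancel₀ _ (by positivity)]; exact half_lt_self hε⟩
  obtain ⟨c, hcb, hcL⟩ : ∃ c ∈ Set.Ioo 0 b, ∀ v ∈ Set.Ioo 0 c,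
      |f v / (q v * (v * R v) / (2 * √(q 0 - q v))) - L| < η := by
    obtain ⟨c, hc, hcs⟩ := (mem_nhdsGT_iff_exists_Ioo_subset' hb).1
      ((Metric.tendsto_nhds.1 hL) η hη)
    refine ⟨min c (b / 2), ⟨lt_min hc (half_pos hb), min_lt_of_right_lt (half_lt_self hb)⟩, ?_⟩
    intro v hv
    exact hcs ⟨hv.1, hv.2.trans_le (min_le_left _ _)⟩
  have hcb' := Set.Ioo_subset_Ico_self hcb
  have hqc : √(q c) < √(q 0) := Real.sqrt_lt_sqrt (h.pos c hcb').le
    (h.strictAntiOn h0 hcb' hcb.1)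
  have hid : Tendsto (fun A : ℝ => A * (π / 2)) (𝓝[<] √(q 0)) (𝓝 (√(q 0) * (π / 2))) :=
    (tendsto_id.mono_left nhdsWithin_le_nhds).mul_const _
  have hT : Tendsto (fun A : ℝ => η * (A * (π / 2)) +
      |L * (A * (π / 2)) - L * (√(q 0) * (π / 2))|) (𝓝[<] √(q 0))
      (𝓝 (η * (√(q 0) * (π / 2)))) := by
    simpa using (hid.const_mul η).add
      (((hid.const_mul L).sub_const (L * (√(q 0) * (π / 2)))).abs)
  filter_upwards [hT.eventually (gt_mem_nhds hηε), Ioo_mem_nhdsLT hsq,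
    Ioo_mem_nhdsLT hqc] with A h3 hA hAc
  obtain ⟨hd, hqd⟩ := hδ A hA
  have hdc : δ A < c := by
    refine h.lt_of_apply_lt (Set.Ioo_subset_Ico_self hd) hcb' ?_
    rw [hqd]
    exact (Real.sqrt_lt' hA.1).1 hAc.1
  have hstart := h.near_start (L := L) (η := η) hf hA.1 hd hqd (by
    intro v hv
    have hv' : v ∈ Set.Ico 0 b := ⟨hv.1.le, hv.2.trans hd.2⟩
    have hv0 := hv.1
    have hqv := h.pos v hv'
    have hRv := h.slope_pos v hv'
    have hs : 0 < √(q 0 - q v) := Real.sqrt_pos.2 (sub_pos.2 (h.strictAntiOn h0 hv' hv.1))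
    have hw : 0 < q v * (v * R v) / (2 * √(q 0 - q v)) := by positivity
    have := (hcL v ⟨hv.1, hv.2.trans hdc⟩).le
    set w := q v * (v * R v) / (2 * √(q 0 - q v))
    rw [show f v - L * w = (f v / w - L) * w by
      rw [sub_mul, div_mul_cancel₀ _ hw.ne'], abs_mul, abs_of_pos hw]
    exact mul_le_mul_of_nonneg_right this hw.le)
  rw [Real.dist_eq]
  refine lt_of_le_of_lt (abs_sub_le _ (L * (A * (π / 2))) _) (lt_of_le_of_lt ?_ h3)
  gcongr

end IsBump

section LinearFactors

variable {ι : Type*} {α s : ι → ℝ} {b c : ℝ}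

theorem linear_factor_pos (hα : ∀ j, 0 < α j) (hs : ∀ j, s j = 1 ∨ s j = -1)
    (hb : ∀ j, s j = -1 → b ≤ α j) {v : ℝ} (hv : v ∈ Set.Ico 0 b) (j : ι) :
    0 < α j + s j * v := by
  rcases hs j with h | h
  · rw [h]; linarith [hα j, hv.1]
  · rw [h]; linarith [hb j h, hv.2]

theorem continuousOn_one_div_linear_factor (hα : ∀ j, 0 < α j) (hs : ∀ j, s j = 1 ∨ s j = -1)
    (hb : ∀ j, s j = -1 → b ≤ α j) (i : ι) :
    ContinuousOn (fun v => 1 / (α i + s i * v)) (Set.Ico 0 b) :=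
  continuousOn_const.div (by fun_prop) fun _ hv => (linear_factor_pos hα hs hb hv i).ne'

variable [Fintype ι]

theorem mul_sum_inv_linear_factor (hα : ∀ j, 0 < α j) (hs : ∀ j, s j = 1 ∨ s j = -1)
    (hbal : ∑ j, s j / α j = 0) {v : ℝ} (hv : ∀ j, 0 < α j + s j * v) :
    v * ∑ j, 1 / (α j * (α j + s j * v)) = -∑ j, s j * (1 / (α j + s j * v)) := by
  rw [← sub_eq_zero, sub_neg_eq_add, Finset.mul_sum, ← Finset.sum_add_distrib, ← hbal]
  refine Finset.sum_congr rfl fun j _ => ?_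
  have h1 := (hα j).ne'
  have h2 := (hv j).ne'
  have h3 : s j * s j = 1 := by rcases hs j with h | h <;> simp [h]
  have h4 : v = s j * (α j + s j * v - α j) := by linear_combination (-v) * h3
  generalize α j + s j * v = w at h2 h4 ⊢
  rw [h4]
  field_simp
  ring

theorem isBump_prod_linear [Nonempty ι] (hα : ∀ j, 0 < α j) (hs : ∀ j, s j = 1 ∨ s j = -1)
    (hbal : ∑ j, s j / α j = 0) (hb : ∀ j, s j = -1 → b ≤ α j) :
    IsBump (fun v => ∏ j, (α j + s j * v)) (fun v => ∑ j, 1 / (α j * (α j + s j * v))) b where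
  pos v hv := Finset.prod_pos fun j _ => linear_factor_pos hα hs hb hv j
  continuousOn := continuousOn_finsetSum _ fun j _ => by
    refine continuousOn_const.div (by fun_prop) fun v hv => ?_
    exact (mul_pos (hα j) (linear_factor_pos hα hs hb hv j)).ne'
  slope_pos v hv := Finset.sum_pos (fun j _ => one_div_pos.2
    (mul_pos (hα j) (linear_factor_pos hα hs hb hv j))) Finset.univ_nonempty
  hasDerivAt v hv := by
    have hpos := linear_factor_pos hα hs hb hv
    rw [mul_sum_inv_linear_factor hα hs hbal hpos]
    have hd : ∀ j, HasDerivAt (fun v => α j + s j * v) (s j) v := fun j => by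
      simpa using ((hasDerivAt_id v).const_mul (s j)).const_add (α j)
    have hlog := logDeriv_prod (s := Finset.univ) (f := fun j v => α j + s j * v) (x := v)
      (fun j _ => (hpos j).ne') fun j _ => (hd j).differentiableAt
    have hdiff : DifferentiableAt ℝ (fun v => ∏ j, (α j + s j * v)) v := by fun_prop
    have hne : ∏ j, (α j + s j * v) ≠ 0 := (Finset.prod_pos fun j _ => hpos j).ne'
    refine hdiff.hasDerivAt.congr_deriv ?_
    rw [logDeriv_apply, div_eq_iff hne] at hlog
    rw [hlog, mul_neg, neg_neg, mul_comm]
    congr 1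
    refine Finset.sum_congr rfl fun j _ => ?_
    rw [logDeriv_apply, (hd j).deriv, mul_one_div]

theorem tendsto_ratio_linear_factor [DecidableEq ι] (hα : ∀ j, 0 < α j)
    (hs : ∀ j, s j = 1 ∨ s j = -1) (hbal : ∑ j, s j / α j = 0) (hb : 0 < b) {T : Finset ι}
    (hTne : T.Nonempty) (hT : ∀ j ∈ T, s j = -1 ∧ α j = b)
    (hT' : ∀ j ∉ T, s j = -1 → b < α j) (i : ι) :
    Tendsto (fun v => 1 / (α i + s i * v) / (v * ∑ j, 1 / (α j * (α j + s j * v)))) (𝓝[<] b)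
      (𝓝 (if i ∈ T then 1 / (T.card : ℝ) else 0)) := by
  have hb' : ∀ j, s j = -1 → b ≤ α j := fun j hj => by
    by_cases h : j ∈ T
    · exact (hT j h).2.ge
    · exact (hT' j h hj).le
  have hlim : ∀ j, Tendsto (fun v => (b - v) * (1 / (α j + s j * v))) (𝓝[<] b)
      (𝓝 (if j ∈ T then 1 else 0)) := by
    intro j
    split_ifs with h
    · refine tendsto_const_nhds.congr' ?_
      filter_upwards [self_mem_nhdsWithin] with v hv
      have : b - v ≠ 0 := (sub_pos.2 hv).ne'
      rw [(hT j h).1, (hT j h).2, neg_one_mul, ← sub_eq_add_neg, mul_one_div_cancel this]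
    · have hne : α j + s j * b ≠ 0 := by
        rcases hs j with hj | hj
        · rw [hj]; linarith [hα j]
        · rw [hj]; linarith [hT' j h hj]
      have : ContinuousAt (fun v => (b - v) * (1 / (α j + s j * v))) b := by
        refine ContinuousAt.mul (by fun_prop) (continuousAt_const.div (by fun_prop) hne)
      have := this.tendsto.mono_left (nhdsWithin_le_nhds (s := Set.Iio b))
      simpa using this
  have hsum : Tendsto (fun v => -∑ j, s j * ((b - v) * (1 / (α j + s j * v)))) (𝓝[<] b)
      (𝓝 (T.card : ℝ)) := by
    have := (tendsto_finsetSum Finset.univ fun j _ => (hlim j).const_mul (s j)).neg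
    convert this using 2
    simp only [mul_ite, mul_one, mul_zero, Finset.sum_ite_mem, Finset.univ_inter]
    rw [Finset.sum_congr rfl fun j hj => (hT j hj).1]
    simp
  have hcard : (T.card : ℝ) ≠ 0 := by exact_mod_cast hTne.card_pos.ne'
  have := (hlim i).div hsum hcard
  rw [ite_div, zero_div] at this
  refine this.congr' ?_
  filter_upwards [Ioo_mem_nhdsLT hb] with v hv
  have hpos := linear_factor_pos hα hs hb' (Set.Ioo_subset_Ico_self hv)
  have hbv : b - v ≠ 0 := (sub_pos.2 hv.2).ne'
  simp only [Pi.div_apply]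
  rw [mul_sum_inv_linear_factor hα hs hbal hpos]
  simp_rw [mul_left_comm (s _) (b - v)]
  rw [← Finset.mul_sum, ← mul_neg, mul_div_mul_left _ _ hbv]

/-- Limits of the integral over the part `[0, δ A]` of a component of `{q ≥ A ^ 2}`, where `q` is a
product of linear factors with a maximum at `0`. -/
theorem one_sided_limits [Nonempty ι] [DecidableEq ι] (hα : ∀ j, 0 < α j)
    (hs : ∀ j, s j = 1 ∨ s j = -1) (hbal : ∑ j, s j / α j = 0) (hb : 0 < b) {T : Finset ι}
    (hTne : T.Nonempty) (hT : ∀ j ∈ T, s j = -1 ∧ α j = b)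
    (hT' : ∀ j ∉ T, s j = -1 → b < α j) {δ : ℝ → ℝ}
    (hδ : ∀ A ∈ Set.Ioo 0 √(∏ j, α j), δ A ∈ Set.Ioo 0 b ∧ ∏ j, (α j + s j * δ A) = A ^ 2)
    (i : ι) :
    (∀ A ∈ Set.Ioo 0 √(∏ j, α j), IntervalIntegrable
      (fun v => 1 / (α i + s i * v) * (1 / √((∏ j, (α j + s j * v)) / A ^ 2 - 1)))
      volume 0 (δ A)) ∧
    Tendsto (fun A => ∫ v in 0..δ A,
      1 / (α i + s i * v) * (1 / √((∏ j, (α j + s j * v)) / A ^ 2 - 1))) (𝓝[>] 0)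
      (𝓝 ((if i ∈ T then 1 / (T.card : ℝ) else 0) * π)) ∧
    Tendsto (fun A => ∫ v in 0..δ A,
      1 / (α i + s i * v) * (1 / √((∏ j, (α j + s j * v)) / A ^ 2 - 1))) (𝓝[<] √(∏ j, α j))
      (𝓝 (1 / α i * (π / √(2 * ∑ j, (1 / α j) ^ 2)))) := by
  have hb' : ∀ j, s j = -1 → b ≤ α j := fun j hj => by
    by_cases h : j ∈ T
    · exact (hT j h).2.ge
    · exact (hT' j h hj).le
  have hbump := isBump_prod_linear hα hs hbal hb'
  have hf := continuousOn_one_div_linear_factor hα hs hb' i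
  have hq0 : ∏ j, α j = ∏ j, (α j + s j * 0) := by simp
  refine ⟨fun A hA => hbump.intervalIntegrable_kernel hf hA.1 (hδ A hA).1 (hδ A hA).2,
    hbump.tendsto_integral_zero hb hf
      (tendsto_ratio_linear_factor hα hs hbal hb hTne hT hT' i) (by rwa [hq0] at hδ), ?_⟩
  have := hbump.tendsto_integral_max hb hf (δ := δ) (by rwa [hq0] at hδ)
  simpa [← sq] using this

/-- Limits of the integral over the whole component `[γ A, δ A]`; the left half is the right half
for the reflected signs. -/
theorem two_sided_limits [Nonempty ι] [DecidableEq ι] (hα : ∀ j, 0 < α j)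
    (hs : ∀ j, s j = 1 ∨ s j = -1) (hbal : ∑ j, s j / α j = 0) (hb : 0 < b) (hc : 0 < c)
    {T U : Finset ι} (hTne : T.Nonempty) (hT : ∀ j ∈ T, s j = -1 ∧ α j = b)
    (hT' : ∀ j ∉ T, s j = -1 → b < α j) (hUne : U.Nonempty) (hU : ∀ j ∈ U, s j = 1 ∧ α j = c)
    (hU' : ∀ j ∉ U, s j = 1 → c < α j) {γ δ : ℝ → ℝ}
    (hδ : ∀ A ∈ Set.Ioo 0 √(∏ j, α j), δ A ∈ Set.Ioo 0 b ∧ ∏ j, (α j + s j * δ A) = A ^ 2)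
    (hγ : ∀ A ∈ Set.Ioo 0 √(∏ j, α j), γ A ∈ Set.Ioo (-c) 0 ∧
      ∏ j, (α j + s j * γ A) = A ^ 2) (i : ι) :
    Tendsto (fun A => ∫ v in γ A..δ A,
      1 / ((α i + s i * v) * √((∏ j, (α j + s j * v)) / A ^ 2 - 1))) (𝓝[>] 0)
      (𝓝 ((if i ∈ T then 1 / (T.card : ℝ) else 0) * π +
        (if i ∈ U then 1 / (U.card : ℝ) else 0) * π)) ∧
    Tendsto (fun A => ∫ v in γ A..δ A,
      1 / ((α i + s i * v) * √((∏ j, (α j + s j * v)) / A ^ 2 - 1))) (𝓝[<] √(∏ j, α j))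
      (𝓝 (2 * π / (α i * √(2 * ∑ j, (1 / α j) ^ 2)))) := by
  have hP : 0 < √(∏ j, α j) := Real.sqrt_pos.2 (Finset.prod_pos fun j _ => hα j)
  obtain ⟨hi1, hz1, hm1⟩ := one_sided_limits hα hs hbal hb hTne hT hT' hδ i
  obtain ⟨hi2, hz2, hm2⟩ := one_sided_limits (s := fun j => -s j) (T := U) (b := c)
    (δ := fun A => -γ A) hα
    (fun j => by rcases hs j with h | h <;> simp [h])
    (by simpa [neg_div] using hbal) hc hUne
    (fun j hj => by simpa using hU j hj) (fun j hj h => hU' j hj (neg_injective h))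
    (fun A hA => ⟨⟨neg_pos.2 (hγ A hA).1.2, neg_lt.1 (hγ A hA).1.1⟩, by
      simpa using (hγ A hA).2⟩) i
  have hsplit : ∀ A ∈ Set.Ioo 0 √(∏ j, α j),
      (∫ v in 0..δ A, 1 / (α i + s i * v) * (1 / √((∏ j, (α j + s j * v)) / A ^ 2 - 1))) +
      (∫ v in 0..-γ A,
        1 / (α i + -s i * v) * (1 / √((∏ j, (α j + -s j * v)) / A ^ 2 - 1))) =
      ∫ v in γ A..δ A, 1 / ((α i + s i * v) * √((∏ j, (α j + s j * v)) / A ^ 2 - 1)) := by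
    intro A hA
    set g := fun v => 1 / (α i + s i * v) * (1 / √((∏ j, (α j + s j * v)) / A ^ 2 - 1)) with hg
    have hneg : (fun v => 1 / (α i + -s i * v) *
        (1 / √((∏ j, (α j + -s j * v)) / A ^ 2 - 1))) = fun v => g (-v) := by
      ext v; simp [hg]
    have h1 : IntervalIntegrable g volume (γ A) 0 := by
      have := hi2 A hA
      rw [hneg] at this
      simpa using ((IntervalIntegrable.iff_comp_neg (f := g)
        (a := γ A) (b := 0)).2 (by simpa using this.symm))
    rw [hneg, intervalIntegral.integral_comp_neg, neg_neg, neg_zero, add_comm,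
      intervalIntegral.integral_add_adjacent_intervals h1 (hi1 A hA)]
    simp only [hg, one_div_mul_one_div]
  constructor
  · refine (hz1.add hz2).congr' ?_
    filter_upwards [Ioo_mem_nhdsGT hP] with A hA
    exact hsplit A hA
  · have := hm1.add hm2
    rw [show 1 / α i * (π / √(2 * ∑ j, (1 / α j) ^ 2)) +
      1 / α i * (π / √(2 * ∑ j, (1 / α j) ^ 2)) =
      2 * π / (α i * √(2 * ∑ j, (1 / α j) ^ 2)) by
        rw [div_mul_div_comm, one_mul, ← add_div, ← two_mul π]] at this
    refine this.congr' ?_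
    filter_upwards [Ioo_mem_nhdsLT hP] with A hA
    exact hsplit A hA

end LinearFactors

end

open Filter intervalIntegral in
/-- Limits of the angle increments `β_j(A)` as `A → 0⁺` and as
`A → (α₁⋯α_m)^{1/2}` from below, for fixed `α₁,…,α_m` satisfying the balance condition,
where `k` is the multiplicity of the minimum among `α₁,…,α_a` (attained by the first `k`)
and `l` the multiplicity of the minimum among `α_{a+1},…,α_m` (attained by the last `l`). -/
theorem beta_limits
    (m a k l : ℕ) (hm : 2 ≤ m) (ha1 : 1 ≤ a) (ham : a ≤ m - 1)
    (hk1 : 1 ≤ k) (hka : k ≤ a) (hl1 : 1 ≤ l) (hlm : l ≤ m - a)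
    (α : Fin m → ℝ) (hα : ∀ j, 0 < α j)
    (hbal : (∑ j ∈ Finset.univ.filter fun j : Fin m => (j : ℕ) < a, 1 / α j) =
            (∑ j ∈ Finset.univ.filter fun j : Fin m => a ≤ (j : ℕ), 1 / α j))
    (hhead : ∀ j : Fin m, (j : ℕ) < k → α j = α ⟨0, by omega⟩)
    (hheadlt : ∀ j : Fin m, k ≤ (j : ℕ) → (j : ℕ) < a → α ⟨0, by omega⟩ < α j)
    (htail : ∀ j : Fin m, m - l ≤ (j : ℕ) → α j = α ⟨m - 1, by omega⟩)
    (htaillt : ∀ j : Fin m, a ≤ (j : ℕ) → (j : ℕ) < m - l → α ⟨m - 1, by omega⟩ < α j)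
    (γ δ : ℝ → ℝ)
    (hγ : ∀ A ∈ Set.Ioo 0 (Real.sqrt (∏ j, α j)),
      γ A ∈ Set.Ioo (-(α ⟨0, by omega⟩)) 0 ∧ quadProd a α (γ A) = A ^ 2 ∧
      ∀ x ∈ Set.Ioo (-(α ⟨0, by omega⟩)) 0, quadProd a α x = A ^ 2 → x = γ A)
    (hδ : ∀ A ∈ Set.Ioo 0 (Real.sqrt (∏ j, α j)),
      δ A ∈ Set.Ioo 0 (α ⟨m - 1, by omega⟩) ∧ quadProd a α (δ A) = A ^ 2 ∧
      ∀ x ∈ Set.Ioo 0 (α ⟨m - 1, by omega⟩), quadProd a α x = A ^ 2 → x = δ A)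
    (β : Fin m → ℝ → ℝ)
    (hβ₁ : ∀ (j : Fin m), (j : ℕ) < a → ∀ A ∈ Set.Ioo 0 (Real.sqrt (∏ j, α j)),
      β j A = -∫ v in (γ A)..(δ A),
        1 / ((α j + v) * Real.sqrt (quadProd a α v / A ^ 2 - 1)))
    (hβ₂ : ∀ (j : Fin m), a ≤ (j : ℕ) → ∀ A ∈ Set.Ioo 0 (Real.sqrt (∏ j, α j)),
      β j A = ∫ v in (γ A)..(δ A),
        1 / ((α j - v) * Real.sqrt (quadProd a α v / A ^ 2 - 1))) :
    -- limits as `A → 0⁺`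
    ((∀ j : Fin m, (j : ℕ) < k →
        Tendsto (β j) (nhdsWithin 0 (Set.Ioi 0)) (nhds (-(Real.pi / k)))) ∧
      (∀ j : Fin m, k ≤ (j : ℕ) → (j : ℕ) < m - l →
        Tendsto (β j) (nhdsWithin 0 (Set.Ioi 0)) (nhds 0)) ∧
      (∀ j : Fin m, m - l ≤ (j : ℕ) →
        Tendsto (β j) (nhdsWithin 0 (Set.Ioi 0)) (nhds (Real.pi / l)))) ∧
    -- limits as `A → (α₁⋯α_m)^{1/2}` from below
    ((∀ j : Fin m, (j : ℕ) < a →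
        Tendsto (β j)
          (nhdsWithin (Real.sqrt (∏ i, α i)) (Set.Iio (Real.sqrt (∏ i, α i))))
          (nhds (-(2 * Real.pi / (α j * Real.sqrt (2 * ∑ i, (1 / α i) ^ 2)))))) ∧
      (∀ j : Fin m, a ≤ (j : ℕ) →
        Tendsto (β j)
          (nhdsWithin (Real.sqrt (∏ i, α i)) (Set.Iio (Real.sqrt (∏ i, α i))))
          (nhds (2 * Real.pi / (α j * Real.sqrt (2 * ∑ i, (1 / α i) ^ 2)))))) := by
  classical
  have hm0 : 0 < m := by omega
  have : Nonempty (Fin m) := ⟨⟨0, hm0⟩⟩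
  set s : Fin m → ℝ := fun j => if (j : ℕ) < a then 1 else -1 with hs_def
  have hs1 : ∀ j : Fin m, (j : ℕ) < a → s j = 1 := fun j hj => if_pos hj
  have hs2 : ∀ j : Fin m, a ≤ (j : ℕ) → s j = -1 := fun j hj => if_neg hj.not_gt
  have hs : ∀ j, s j = 1 ∨ s j = -1 := fun j =>
    (lt_or_ge (j : ℕ) a).imp (hs1 j) (hs2 j)
  have hs1' : ∀ j, s j = 1 → (j : ℕ) < a := fun j h => by
    by_contra hj
    norm_num [hs2 j (not_lt.1 hj)] at h
  have hs2' : ∀ j, s j = -1 → a ≤ (j : ℕ) := fun j h => by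
    by_contra hj
    norm_num [hs1 j (not_le.1 hj)] at h
  have hQ : ∀ v, quadProd a α v = ∏ j, (α j + s j * v) := fun v => by
    refine Finset.prod_congr rfl fun j _ => ?_
    rcases lt_or_ge (j : ℕ) a with hj | hj
    · rw [if_pos hj, hs1 j hj, one_mul]
    · rw [if_neg hj.not_gt, hs2 j hj]
      ring
  have hbal' : ∑ j, s j / α j = 0 := by
    rw [← Finset.sum_filter_add_sum_filter_not Finset.univ (fun j : Fin m => (j : ℕ) < a)]
    simp only [not_lt]
    rw [Finset.sum_congr rfl fun j hj => by rw [hs1 j (Finset.mem_filter.1 hj).2], hbal,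
      ← Finset.sum_add_distrib]
    refine Finset.sum_eq_zero fun j hj => ?_
    rw [hs2 j (Finset.mem_filter.1 hj).2]
    ring
  set T := Finset.univ.filter fun j : Fin m => m - l ≤ (j : ℕ) with hT_def
  set U := Finset.univ.filter fun j : Fin m => (j : ℕ) < k with hU_def
  have hmemT : ∀ j, j ∈ T ↔ m - l ≤ (j : ℕ) := fun j => by simp [hT_def]
  have hmemU : ∀ j, j ∈ U ↔ (j : ℕ) < k := fun j => by simp [hU_def]
  have hTcard : T.card = l := by
    have h1 := Finset.card_filter_add_card_filter_not (s := (Finset.univ : Finset (Fin m)))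
      (fun j => (j : ℕ) < m - l)
    simp only [not_lt, Fin.card_filter_val_lt, Finset.card_univ, Fintype.card_fin] at h1
    change min m (m - l) + T.card = m at h1
    omega
  have hUcard : U.card = k := by
    simp only [hU_def, Fin.card_filter_val_lt]
    omega
  have main := two_sided_limits (T := T) (U := U) (γ := γ) (δ := δ) hα hs hbal'
    (hα ⟨m - 1, by omega⟩) (hα ⟨0, hm0⟩) (Finset.card_pos.1 (by omega))
    (fun j hj => by
      rw [hmemT] at hj
      exact ⟨hs2 j (by omega), htail j hj⟩)
    (fun j hj hsj => by
      rw [hmemT] at hj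
      exact htaillt j (hs2' j hsj) (not_le.1 hj))
    (Finset.card_pos.1 (by omega))
    (fun j hj => by
      rw [hmemU] at hj
      exact ⟨hs1 j (by omega), hhead j hj⟩)
    (fun j hj hsj => by
      rw [hmemU] at hj
      exact hheadlt j (not_lt.1 hj) (hs1' j hsj))
    (fun A hA => ⟨(hδ A hA).1, (hQ _).symm.trans (hδ A hA).2.1⟩)
    (fun A hA => ⟨(hγ A hA).1, (hQ _).symm.trans (hγ A hA).2.1⟩)
  simp_rw [hmemT, hmemU, hTcard, hUcard, ← hQ] at main
  have hP : 0 < Real.sqrt (∏ j, α j) := Real.sqrt_pos.2 (Finset.prod_pos fun j _ => hα j)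
  have hev0 := Ioo_mem_nhdsGT hP
  have hevP := Ioo_mem_nhdsLT hP
  have hβneg : ∀ j : Fin m, (j : ℕ) < a → ∀ A ∈ Set.Ioo 0 (Real.sqrt (∏ j, α j)),
      -(∫ v in (γ A)..(δ A), 1 / ((α j + s j * v) * Real.sqrt (quadProd a α v / A ^ 2 - 1))) =
        β j A := fun j hj A hA => by
    rw [hβ₁ j hj A hA, hs1 j hj]
    simp only [one_mul]
  have hβpos : ∀ j : Fin m, a ≤ (j : ℕ) → ∀ A ∈ Set.Ioo 0 (Real.sqrt (∏ j, α j)),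
      (∫ v in (γ A)..(δ A), 1 / ((α j + s j * v) * Real.sqrt (quadProd a α v / A ^ 2 - 1))) =
        β j A := fun j hj A hA => by
    rw [hβ₂ j hj A hA, hs2 j hj]
    simp only [neg_one_mul, ← sub_eq_add_neg]
  refine ⟨⟨fun j hj => ?_, fun j hkj hjl => ?_, fun j hj => ?_⟩, fun j hj => ?_, fun j hj => ?_⟩
  · have := (main j).1.neg
    rw [if_neg (by omega), if_pos hj, zero_mul, zero_add, one_div_mul_eq_div] at this
    exact this.congr' (Filter.mem_of_superset hev0 (hβneg j (by omega)))
  · have := (main j).1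
    rw [if_neg (by omega), if_neg (by omega), zero_mul, zero_add] at this
    rcases lt_or_ge (j : ℕ) a with hja | hja
    · have := this.neg
      rw [neg_zero] at this
      exact this.congr' (Filter.mem_of_superset hev0 (hβneg j hja))
    · exact this.congr' (Filter.mem_of_superset hev0 (hβpos j hja))
  · have := (main j).1
    rw [if_pos hj, if_neg (by omega), zero_mul, add_zero, one_div_mul_eq_div] at this
    exact this.congr' (Filter.mem_of_superset hev0 (hβpos j (by omega)))
  · exact (main j).2.neg.congr' (Filter.mem_of_superset hevP (hβneg j hj))
  · exact (main j).2.congr' (Filter.mem_of_superset hevP (hβpos j hj))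
end

section
/- Let w₁, w₂ : ℝ → ℂ be differentiable functions satisfying dw₁/dt = conj(w₂) and dw₂/dt = −conj(w₁). Then w₁ and w₂ are twice differentiable with w₁″ = −w₁ and w₂″ = −w₂, and for all t ∈ ℝ, w₁(t+π) = −w₁(t) and w₂(t+π) = −w₂(t); in particular every solution is periodic with period 2π. (This is the m = 2, a = 1 case of the evolution equation, and shows that the corresponding angle increments over one period of u are β₁ = −π, β₂ = π for all initial data.) -/
open scoped ComplexConjugate

/-- A solution of the harmonic oscillator `f' = g`, `g' = -f` is antiperiodic with antiperiod
`π`. -/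
theorem antiperiodic_pi_of_hasDerivAt {E : Type*} [NormedAddCommGroup E] [NormedSpace ℝ E]
    {f g : ℝ → E} (hf : ∀ t, HasDerivAt f (g t) t) (hg : ∀ t, HasDerivAt g (-f t) t) :
    Function.Antiperiodic f Real.pi := by
  intro s
  have key (t : ℝ) :
      HasDerivAt (fun t => Real.cos t • f (s + t) - Real.sin t • g (s + t)) 0 t := by
    have hf' := (Real.hasDerivAt_cos t).smul ((hf (s + t)).comp_const_add s t)
    have hg' := (Real.hasDerivAt_sin t).smul ((hg (s + t)).comp_const_add s t)
    refine (hf'.sub hg').congr_deriv ?_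
    module
  have hconst := is_const_of_deriv_eq_zero (fun t => (key t).differentiableAt)
    (fun t => (key t).deriv) Real.pi 0
  simp only [Real.cos_pi, Real.sin_pi, Real.cos_zero, Real.sin_zero, neg_smul, one_smul,
    zero_smul, sub_zero, add_zero] at hconst
  rw [← hconst, neg_neg]

/-- If `w₁, w₂ : ℝ → ℂ` satisfy `dw₁/dt = conj(w₂)` and
`dw₂/dt = −conj(w₁)` then they are twice differentiable with `w₁″ = −w₁`, `w₂″ = −w₂`,
satisfy `w_j(t+π) = −w_j(t)`, and in particular are periodic with period `2π`. -/
theorem m_eq_two_evolution_periodic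
    (w₁ w₂ : ℝ → ℂ)
    (h₁ : ∀ t : ℝ, HasDerivAt w₁ (conj (w₂ t)) t)
    (h₂ : ∀ t : ℝ, HasDerivAt w₂ (-conj (w₁ t)) t) :
    (∀ t : ℝ, HasDerivAt (deriv w₁) (-w₁ t) t) ∧
    (∀ t : ℝ, HasDerivAt (deriv w₂) (-w₂ t) t) ∧
    (∀ t : ℝ, w₁ (t + Real.pi) = -w₁ t) ∧
    (∀ t : ℝ, w₂ (t + Real.pi) = -w₂ t) ∧
    Function.Periodic w₁ (2 * Real.pi) ∧
    Function.Periodic w₂ (2 * Real.pi) := by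
  have h₁' (t : ℝ) : HasDerivAt (fun t => conj (w₂ t)) (-w₁ t) t := by
    simpa using (h₂ t).star
  have h₂' (t : ℝ) : HasDerivAt (fun t => -conj (w₁ t)) (-w₂ t) t := by
    simpa using (h₁ t).star.fun_neg
  have ha₁ := antiperiodic_pi_of_hasDerivAt h₁ h₁'
  have ha₂ := antiperiodic_pi_of_hasDerivAt h₂ h₂'
  have hd₁ : deriv w₁ = fun t => conj (w₂ t) := funext fun t => (h₁ t).deriv
  have hd₂ : deriv w₂ = fun t => -conj (w₁ t) := funext fun t => (h₂ t).deriv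
  exact ⟨hd₁ ▸ h₁', hd₂ ▸ h₂', ha₁, ha₂, ha₁.periodic_two_mul, ha₂.periodic_two_mul⟩
end

section
/- Let m ≥ 3, 1 ≤ a ≤ m−1, and α₁,…,α_m > 0 with ∑_{j=1}^a 1/α_j = ∑_{j=a+1}^m 1/α_j. Let u, θ₁,…,θ_m : ℝ → ℝ be a solution as in the periodic case: u and θ = θ₁+⋯+θ_m periodic with period T > 0, satisfying α_j+u > 0 (j ≤ a), α_j−u > 0 (j > a), du/dt = 2Q(u)^{1/2} cos θ, dθ_j/dt = ∓Q(u)^{1/2} sin θ/(α_j±u), with Q(u)^{1/2} sin θ ≡ A ∈ (0,(α₁⋯α_m)^{1/2}), and θ_j(t+T) = θ_j(t) + β_j. Suppose β_j = π·a_j/b for integers a₁,…,a_m, b with b > 0. Define w_j(t) = e^{iθ_j(t)}·√(α_j+u(t)) for j ≤ a and w_j(t) = e^{iθ_j(t)}·√(α_j−u(t)) for j > a, and for c ∈ ℝ define Φ : ℝ × ℝᵐ → ℂᵐ by Φ(t,x) = (w₁(t)x₁,…,w_m(t)x_m) and N = Φ(ℝ × {x : x₁²+⋯+x_a² − x_{a+1}²−⋯−x_m²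 = c}). Then: (i) w_j(t+bT) = (−1)^{a_j}·w_j(t) for all j and t, so Φ(t+2bT, x) = Φ(t,x); (ii) N is a closed subset of ℂᵐ; (iii) for every t and every x ≠ 0 on the quadric, the real subspace of ℂᵐ spanned by (w₁′(t)x₁,…,w_m′(t)x_m) and the vectors (w₁(t)y₁,…,w_m(t)y_m) with x₁y₁+⋯+x_ay_a − x_{a+1}y_{a+1}−⋯−x_my_m = 0 has dimension m and is a special Lagrangian plane; (iv) if c = 0, then N is a cone, i.e. r·N = N for every r > 0, with 0 ∈ N its only singular point. -/
open scoped ComplexConjugate Pointwise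

/-- The standard Hermitian inner product on `ℂ^m`. -/
noncomputable def hermInner {m : ℕ} (v w : Fin m → ℂ) : ℂ :=
  ∑ j, v j * conj (w j)

/-- The standard symplectic form `ω(v,w) = Im ⟨v,w⟩` on `ℂ^m` viewed as a real vector space. -/
noncomputable def omegaForm {m : ℕ} (v w : Fin m → ℂ) : ℝ :=
  (hermInner v w).im

/-- The holomorphic volume form: the determinant of the complex `m × m` matrix with
columns `v 0, …, v (m-1)`. -/
noncomputable def OmegaForm {m : ℕ} (v : Fin m → (Fin m → ℂ)) : ℂ :=
  Matrix.det (Matrix.of fun i j => v j i)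

/-- A real subspace `V ⊆ ℂ^m` is a special Lagrangian plane if it has real dimension `m`
and both `ω` and `Im Ω` vanish identically on it. -/
def IsSpecialLagrangianPlane {m : ℕ} (V : Submodule ℝ (Fin m → ℂ)) : Prop :=
  Module.finrank ℝ V = m ∧
  (∀ v ∈ V, ∀ w ∈ V, omegaForm v w = 0) ∧
  (∀ v : Fin m → (Fin m → ℂ), (∀ i, v i ∈ V) → (OmegaForm v).im = 0)

/-- Sign `+1` for the first `a` indices, `-1` for the rest. -/
def qsign (a : ℕ) {m : ℕ} (j : Fin m) : ℝ := if (j : ℕ) < a then 1 else -1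

/-- The functions `w_j(t) = e^{iθ_j(t)} √(α_j ± u(t))`. -/
noncomputable def wFun (a : ℕ) {m : ℕ} (α : Fin m → ℝ) (u : ℝ → ℝ) (θ : Fin m → ℝ → ℝ)
    (j : Fin m) (t : ℝ) : ℂ :=
  Complex.exp (Complex.I * (θ j t : ℝ)) *
    (Real.sqrt (if (j : ℕ) < a then α j + u t else α j - u t) : ℝ)

theorem mem_span_insert_weighted_iff {m : ℕ} (w d : Fin m → ℂ) (n : Fin m → ℝ) (v : Fin m → ℂ) :
    v ∈ Submodule.span ℝ (({d} : Set (Fin m → ℂ)) ∪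
      {z | ∃ y : Fin m → ℝ, (∑ j, n j * y j = 0) ∧ z = fun j => w j * (y j : ℂ)}) ↔
    ∃ (k : ℝ) (y : Fin m → ℝ), (∑ j, n j * y j = 0) ∧
      ∀ j, v j = (k : ℂ) * d j + w j * (y j : ℂ) := by
  constructor
  · intro hv
    induction hv using Submodule.span_induction with
    | mem z hz =>
      rcases hz with hz | ⟨y, hy, rfl⟩
      · rw [Set.mem_singleton_iff] at hz
        subst hz
        exact ⟨1, 0, by simp, fun j => by simp⟩
      · exact ⟨0, y, hy, fun j => by simp⟩
    | zero => exact ⟨0, 0, by simp, fun j => by simp⟩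
    | add z z' _ _ hz hz' =>
      obtain ⟨k, y, hy, h⟩ := hz
      obtain ⟨k', y', hy', h'⟩ := hz'
      refine ⟨k + k', y + y', ?_, fun j => ?_⟩
      · simp [mul_add, Finset.sum_add_distrib, hy, hy']
      · simp only [Pi.add_apply, h, h']
        push_cast
        ring
    | smul r z _ hz =>
      obtain ⟨k, y, hy, h⟩ := hz
      refine ⟨r * k, r • y, ?_, fun j => ?_⟩
      · simp only [Pi.smul_apply, smul_eq_mul, mul_left_comm _ r, ← Finset.mul_sum, hy, mul_zero]
      · simp only [Pi.smul_apply, h, Complex.real_smul, smul_eq_mul]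
        push_cast
        ring
  · rintro ⟨k, y, hy, h⟩
    have hv : v = k • d + fun j => w j * (y j : ℂ) := by
      ext j
      simp [h]
    rw [hv]
    exact add_mem (Submodule.smul_mem _ _ (Submodule.subset_span (Or.inl rfl)))
      (Submodule.subset_span (Or.inr ⟨y, hy, rfl⟩))

theorem omegaForm_eq_zero_of_weighted {m : ℕ} (w : Fin m → ℂ) (s n : Fin m → ℝ)
    (hs : ∀ j, 0 < s j) (hw : ∀ j, w j * conj (w j) = s j) (l : ℂ) (k k' : ℝ)
    (y y' : Fin m → ℝ) (hy : ∑ j, n j * y j = 0) (hy' : ∑ j, n j * y' j = 0)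
    (v v' : Fin m → ℂ)
    (hv : ∀ j, v j = (k : ℂ) * (l * w j * ((n j / s j : ℝ) : ℂ)) + w j * (y j : ℂ))
    (hv' : ∀ j, v' j = (k' : ℂ) * (l * w j * ((n j / s j : ℝ) : ℂ)) + w j * (y' j : ℂ)) :
    omegaForm v v' = 0 := by
  have key : hermInner v v' =
      ((Complex.normSq l * (k * k' * ∑ j, n j ^ 2 / s j) + ∑ j, s j * (y j * y' j) : ℝ) : ℂ)
        + l * k * ((∑ j, n j * y' j : ℝ) : ℂ) + conj l * k' * ((∑ j, n j * y j : ℝ) : ℂ) := by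
    unfold hermInner
    push_cast
    simp only [Finset.mul_sum, ← Finset.sum_add_distrib]
    refine Finset.sum_congr rfl fun j _ => ?_
    have hsj : (s j : ℂ) ≠ 0 := by exact_mod_cast (hs j).ne'
    rw [hv, hv', ← Complex.mul_conj]
    simp only [map_add, map_mul, Complex.conj_ofReal]
    push_cast
    have : ((k : ℂ) * (l * w j * (n j / s j)) + w j * y j) *
        (k' * (conj l * conj (w j) * (n j / s j)) + conj (w j) * y' j) =
        (w j * conj (w j)) * ((k * l * (n j / s j) + y j) *
          (k' * conj l * (n j / s j) + y' j)) := by ring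
    rw [this, hw]
    field_simp
    ring
  rw [omegaForm, key, hy, hy']
  simp only [Complex.ofReal_zero, mul_zero, add_zero, Complex.ofReal_im]

/-- Multiplication by `w` after scaling by `l` along `r` with kernel direction `n`. -/
noncomputable def scaleMatrix {m : ℕ} (w : Fin m → ℂ) (r n : Fin m → ℝ) (l : ℂ) :
    Matrix (Fin m) (Fin m) ℂ :=
  Matrix.diagonal w * (1 + Matrix.replicateCol Unit (fun i => (l - 1) * (r i : ℂ)) *
    Matrix.replicateRow Unit (fun i => ((n i / ∑ j, n j * r j : ℝ) : ℂ)))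

theorem det_scaleMatrix {m : ℕ} (w : Fin m → ℂ) (r n : Fin m → ℝ) (l : ℂ)
    (h : ∑ j, n j * r j ≠ 0) :
    (scaleMatrix w r n l).det = (∏ j, w j) * l := by
  rw [scaleMatrix, Matrix.det_mul, Matrix.det_diagonal,
    Matrix.det_one_add_replicateCol_mul_replicateRow]
  congr 1
  have : (fun i => ((n i / ∑ j, n j * r j : ℝ) : ℂ)) ⬝ᵥ (fun i => (l - 1) * (r i : ℂ)) =
      (l - 1) * (((∑ j, n j * r j) / ∑ j, n j * r j : ℝ) : ℂ) := by
    rw [dotProduct, Finset.sum_div]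
    push_cast
    rw [Finset.mul_sum]
    exact Finset.sum_congr rfl fun j _ => by ring
  rw [this, div_self h]
  simp

theorem scaleMatrix_mulVec {m : ℕ} (w : Fin m → ℂ) (r n : Fin m → ℝ) (l : ℂ) (z : Fin m → ℝ)
    (i : Fin m) :
    (scaleMatrix w r n l).mulVec (fun j => (z j : ℂ)) i =
      w i * (z i + (l - 1) * r i * (((∑ j, n j * z j) / ∑ j, n j * r j : ℝ) : ℂ)) := by
  rw [scaleMatrix, ← Matrix.mulVec_mulVec, Matrix.mulVec_diagonal, Matrix.add_mulVec,
    Matrix.one_mulVec, Pi.add_apply, ← Matrix.mulVec_mulVec]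
  congr 2
  simp only [Matrix.mulVec, dotProduct, Matrix.replicateCol_apply, Matrix.replicateRow_apply,
    Finset.univ_unique, Finset.sum_singleton]
  rw [Finset.sum_div]
  push_cast
  congr 1
  exact Finset.sum_congr rfl fun j _ => by ring

theorem isSpecialLagrangianPlane_span {m : ℕ} (w : Fin m → ℂ) (s n : Fin m → ℝ)
    (hs : ∀ j, 0 < s j) (hw : ∀ j, w j * conj (w j) = s j) (hn : n ≠ 0) (l : ℂ)
    (hl : (∏ j, w j) * l ≠ 0) (hl' : ((∏ j, w j) * l).im = 0) :
    IsSpecialLagrangianPlane (Submodule.span ℝ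
      (({fun j => l * w j * ((n j / s j : ℝ) : ℂ)} : Set (Fin m → ℂ)) ∪
      {z | ∃ y : Fin m → ℝ, (∑ j, n j * y j = 0) ∧ z = fun j => w j * (y j : ℂ)})) := by
  set r : Fin m → ℝ := fun j => n j / s j with hr
  have hnr : ∑ j, n j * r j ≠ 0 := by
    obtain ⟨i, hi⟩ := Function.ne_iff.mp hn
    refine (Finset.sum_pos' (fun j _ => ?_) ⟨i, Finset.mem_univ i, ?_⟩).ne'
    · have := hs j
      rw [hr, ← mul_div_assoc, ← sq]
      positivity
    · have := hs i
      have hi' : n i ≠ 0 := hi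
      rw [hr, ← mul_div_assoc, ← sq]
      positivity
  have hdet := det_scaleMatrix w r n l hnr
  have hB : IsUnit (scaleMatrix w r n l) := by
    rw [Matrix.isUnit_iff_isUnit_det, hdet]
    exact hl.isUnit
  have hmem := mem_span_insert_weighted_iff w (fun j => l * w j * ((n j / s j : ℝ) : ℂ)) n
  have himage : ∀ (k : ℝ) (y : Fin m → ℝ), ∑ j, n j * y j = 0 → ∀ i,
      (scaleMatrix w r n l).mulVec (fun j => ((k * r j + y j : ℝ) : ℂ)) i =
        (k : ℂ) * (l * w i * (r i : ℂ)) + w i * (y i : ℂ) := by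
    intro k y hy i
    have : ∑ j, n j * (k * r j + y j) = k * ∑ j, n j * r j := by
      rw [Finset.mul_sum]
      simp only [mul_add, Finset.sum_add_distrib, hy, add_zero]
      exact Finset.sum_congr rfl fun j _ => by ring
    rw [scaleMatrix_mulVec, this, mul_div_cancel_right₀ _ hnr]
    push_cast
    ring
  refine ⟨?_, ?_, ?_⟩
  · let F : (Fin m → ℝ) →ₗ[ℝ] (Fin m → ℂ) :=
      ((Matrix.mulVecLin (scaleMatrix w r n l)).restrictScalars ℝ).comp
        ((Algebra.linearMap ℝ ℂ).compLeft (Fin m))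
    have hF : ∀ z, F z = (scaleMatrix w r n l).mulVec (fun j => (z j : ℂ)) := fun z => rfl
    have hinj : Function.Injective F := by
      intro z z' h
      rw [hF, hF] at h
      have := Matrix.mulVec_injective_iff_isUnit.mpr hB h
      ext j
      exact_mod_cast congrFun this j
    have hrange : LinearMap.range F = Submodule.span ℝ
        (({fun j => l * w j * ((n j / s j : ℝ) : ℂ)} : Set (Fin m → ℂ)) ∪
        {z | ∃ y : Fin m → ℝ, (∑ j, n j * y j = 0) ∧ z = fun j => w j * (y j : ℂ)}) := by
      ext v
      rw [hmem]
      constructor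
      · rintro ⟨z, rfl⟩
        have hy : ∑ j, n j * (z j - (∑ i, n i * z i) / (∑ i, n i * r i) * r j) = 0 := by
          simp only [mul_sub, Finset.sum_sub_distrib, mul_left_comm (n _), ← Finset.mul_sum]
          rw [div_mul_cancel₀ _ hnr, sub_self]
        refine ⟨(∑ i, n i * z i) / ∑ i, n i * r i, _, hy, fun i => ?_⟩
        rw [hF, ← himage _ _ hy i]
        simp
      · rintro ⟨k, y, hy, h⟩
        refine ⟨fun j => k * r j + y j, ?_⟩
        ext i
        rw [hF, h, himage k y hy i]
    rw [← hrange, LinearMap.finrank_range_of_inj hinj]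
    simp
  · intro v hv v' hv'
    obtain ⟨k, y, hy, h⟩ := (hmem v).mp hv
    obtain ⟨k', y', hy', h'⟩ := (hmem v').mp hv'
    exact omegaForm_eq_zero_of_weighted w s n hs hw l k k' y y' hy hy' v v' h h'
  · intro v hv
    choose k y hy h using fun i => (hmem (v i)).mp (hv i)
    have : (Matrix.of fun i j => v j i) = scaleMatrix w r n l *
        (Matrix.of fun i j => k j * r i + y j i).map (algebraMap ℝ ℂ) := by
      ext i j
      rw [Matrix.of_apply, h, ← himage (k j) (y j) (hy j) i]
      rfl
    rw [OmegaForm, this, Matrix.det_mul, hdet, ← RingHom.mapMatrix_apply, ← RingHom.map_det]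
    simp [Complex.mul_im, hl']

/-- The `j`-th factor `α_j ± v` of `quadProd`. -/
noncomputable def quadFactor (a : ℕ) {m : ℕ} (α : Fin m → ℝ) (v : ℝ) (j : Fin m) : ℝ :=
  if (j : ℕ) < a then α j + v else α j - v

theorem wFun_mul_conj (a : ℕ) {m : ℕ} (α : Fin m → ℝ) (u : ℝ → ℝ) (θ : Fin m → ℝ → ℝ)
    (j : Fin m) (t : ℝ) (h : 0 < quadFactor a α (u t) j) :
    wFun a α u θ j t * conj (wFun a α u θ j t) = (quadFactor a α (u t) j : ℂ) := by
  rw [wFun, ← quadFactor, Complex.mul_conj, Complex.normSq_mul, Complex.normSq_ofReal,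
    Complex.normSq_eq_norm_sq, mul_comm Complex.I, Complex.norm_exp_ofReal_mul_I,
    Real.mul_self_sqrt h.le]
  simp

theorem wFun_ne_zero (a : ℕ) {m : ℕ} (α : Fin m → ℝ) (u : ℝ → ℝ) (θ : Fin m → ℝ → ℝ)
    (j : Fin m) (t : ℝ) (h : 0 < quadFactor a α (u t) j) : wFun a α u θ j t ≠ 0 := by
  intro h0
  have := wFun_mul_conj a α u θ j t h
  rw [h0, zero_mul] at this
  exact h.ne (by exact_mod_cast this)

theorem prod_wFun (a : ℕ) {m : ℕ} (α : Fin m → ℝ) (u : ℝ → ℝ) (θ : Fin m → ℝ → ℝ) (t : ℝ)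
    (h : ∀ j, 0 < quadFactor a α (u t) j) :
    ∏ j, wFun a α u θ j t =
      Complex.exp (Complex.I * (∑ j, θ j t : ℝ)) * (Real.sqrt (quadProd a α (u t)) : ℝ) := by
  simp only [wFun, Finset.prod_mul_distrib, ← Complex.exp_sum, ← Finset.mul_sum, quadProd]
  have hprod := Real.sqrt_prod Finset.univ fun j (_ : j ∈ Finset.univ) => (h j).le
  unfold quadFactor at hprod
  rw [hprod]
  push_cast
  rfl

theorem hasDerivAt_wFun (a : ℕ) {m : ℕ} (α : Fin m → ℝ) (u : ℝ → ℝ) (θ : Fin m → ℝ → ℝ)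
    (j : Fin m) (t S Q : ℝ) (hpos : 0 < quadFactor a α (u t) j)
    (hu : HasDerivAt u (2 * Q * Real.cos S) t)
    (hθ : HasDerivAt (θ j)
        (if (j : ℕ) < a then -(Q * Real.sin S) / (α j + u t)
        else (Q * Real.sin S) / (α j - u t)) t) :
    HasDerivAt (wFun a α u θ j)
      (Q * Complex.exp (-(S * Complex.I)) * wFun a α u θ j t *
        ((qsign a j / quadFactor a α (u t) j : ℝ) : ℂ)) t := by
  have hs : HasDerivAt (fun τ => quadFactor a α (u τ) j)
      (qsign a j * (2 * Q * Real.cos S)) t := by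
    unfold quadFactor qsign
    split_ifs
    · simpa using hu.const_add (α j)
    · simpa using hu.const_sub (α j)
  have hθ' : HasDerivAt (θ j)
      (-(qsign a j * (Q * Real.sin S)) / quadFactor a α (u t) j) t := by
    convert hθ using 1
    unfold quadFactor qsign
    split_ifs <;> simp
  have hsq := (hs.sqrt hpos.ne').ofReal_comp
  have hexp := (hθ'.ofReal_comp.const_mul Complex.I).cexp
  have := hexp.mul hsq
  refine this.congr_deriv ?_
  rw [wFun, ← quadFactor]
  have hr : Real.sqrt (quadFactor a α (u t) j) ≠ 0 := (Real.sqrt_pos.mpr hpos).ne'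
  have hr2 : quadFactor a α (u t) j = Real.sqrt (quadFactor a α (u t) j) ^ 2 :=
    (Real.sq_sqrt hpos.le).symm
  generalize Real.sqrt (quadFactor a α (u t) j) = ρ at *
  rw [hr2]
  have hρ : (ρ : ℂ) ≠ 0 := by exact_mod_cast hr
  have hE : Complex.exp (-(S * Complex.I)) = Real.cos S - Real.sin S * Complex.I := by
    rw [← neg_mul, Complex.exp_mul_I, Complex.cos_neg, Complex.sin_neg]
    push_cast
    ring
  rw [hE]
  push_cast
  field_simp
  ring

theorem continuous_wFun (a : ℕ) {m : ℕ} (α : Fin m → ℝ) (u : ℝ → ℝ) (θ : Fin m → ℝ → ℝ)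
    (j : Fin m) (hu : Continuous u) (hθ : Continuous (θ j)) : Continuous (wFun a α u θ j) := by
  unfold wFun
  split_ifs <;> fun_prop

theorem wFun_add_nat_mul (a : ℕ) {m : ℕ} (α : Fin m → ℝ) (u : ℝ → ℝ) (θ : Fin m → ℝ → ℝ)
    (j : Fin m) (T : ℝ) (hu : Function.Periodic u T) (k : ℤ) (b : ℕ) (hb : 0 < b)
    (hθ : ∀ t, θ j (t + T) = θ j t + Real.pi * (k : ℝ) / (b : ℝ)) (t : ℝ) :
    wFun a α u θ j (t + (b : ℝ) * T) = (-1 : ℂ) ^ k * wFun a α u θ j t := by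
  have hiter : ∀ i : ℕ, θ j (t + (i : ℝ) * T) = θ j t + i * (Real.pi * (k : ℝ) / (b : ℝ)) := by
    intro i
    induction i with
    | zero => simp
    | succ i ih =>
      have : t + ((i + 1 : ℕ) : ℝ) * T = t + i * T + T := by push_cast; ring
      rw [this, hθ, ih]
      push_cast
      ring
  have hb' : (b : ℝ) ≠ 0 := by positivity
  have hend : θ j (t + (b : ℝ) * T) = θ j t + k * Real.pi := by
    rw [hiter]
    field_simp
  rw [wFun, wFun, hend, hu.nat_mul b t, ← Complex.exp_pi_mul_I, ← Complex.exp_int_mul]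
  push_cast
  rw [mul_add, Complex.exp_add]
  ring_nf

/-- The union of the images of a closed set under a periodic family of invertible real-diagonal
maps into `ℂ^m` is closed. -/
theorem isClosed_sweep {m : ℕ} (w : Fin m → ℝ → ℂ) (hw : ∀ j, Continuous (w j))
    (hw0 : ∀ j t, w j t ≠ 0) (P : ℝ) (hP : 0 < P) (hper : ∀ j, Function.Periodic (w j) P)
    (C : Set (Fin m → ℝ)) (hC : IsClosed C) :
    IsClosed {z : Fin m → ℂ | ∃ (t : ℝ) (x : Fin m → ℝ), x ∈ C ∧
      z = fun j => w j t * (x j : ℂ)} := by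
  let K : Set (Set.Icc (0 : ℝ) P × (Fin m → ℂ)) :=
    {p | (∀ j, (p.2 j / w j p.1).im = 0) ∧ (fun j => (p.2 j / w j p.1).re) ∈ C}
  have hcont : ∀ j, Continuous fun p : Set.Icc (0 : ℝ) P × (Fin m → ℂ) =>
      p.2 j / w j p.1 := fun j =>
    ((continuous_apply j).comp continuous_snd).div
      ((hw j).comp (continuous_subtype_val.comp continuous_fst)) fun p => hw0 j _
  have hK : IsClosed K := by
    refine IsClosed.inter ?_ ?_
    · change IsClosed {p : Set.Icc (0 : ℝ) P × (Fin m → ℂ) | ∀ j, (p.2 j / w j p.1).im = 0}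
      simp only [Set.ofPred_forall]
      exact isClosed_iInter fun j =>
        isClosed_eq (Complex.continuous_im.comp (hcont j)) continuous_const
    · exact hC.preimage (continuous_pi fun j => Complex.continuous_re.comp (hcont j))
  convert isClosedMap_snd_of_compactSpace K hK using 1
  ext z
  constructor
  · rintro ⟨t, x, hx, rfl⟩
    obtain ⟨t₀, ht₀, ht⟩ : ∃ t₀ ∈ Set.Icc (0 : ℝ) P, ∀ j, w j t = w j t₀ := by
      refine ⟨toIcoMod hP 0 t, ?_, fun j => ?_⟩
      · have := toIcoMod_mem_Ico hP 0 t
        rw [zero_add] at this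
        exact Set.Ico_subset_Icc_self this
      · rw [toIcoMod, (hper j).sub_zsmul_eq]
    have hq : ∀ j, w j t * (x j : ℂ) / w j t₀ = x j := fun j => by
      rw [ht, mul_div_cancel_left₀ _ (hw0 j t₀)]
    refine ⟨(⟨t₀, ht₀⟩, _), ⟨fun j => ?_, ?_⟩, rfl⟩
    · simp [hq]
    · simpa [hq] using hx
  · rintro ⟨⟨t, z'⟩, ⟨him, hre⟩, rfl⟩
    refine ⟨t, _, hre, funext fun j => ?_⟩
    have : (((z' j / w j t).re : ℝ) : ℂ) = z' j / w j t :=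
      Complex.ext (by simp) (by simpa using (him j).symm)
    change z' j = w j t * (((z' j / w j t).re : ℝ) : ℂ)
    rw [this, mul_div_cancel₀ _ (hw0 j t)]

/-- The periodic case with `β_j = π a_j / b` rational multiples of `π`:
the `w_j` satisfy `w_j(t + bT) = (−1)^{a_j} w_j(t)`, the swept-out set `N` is closed, its
tangent planes away from `0` are special Lagrangian, and for `c = 0` it is a cone. -/
theorem periodic_case_closed_special_lagrangian
    (m a : ℕ) (hm : 3 ≤ m) (ha1 : 1 ≤ a) (ham : a ≤ m - 1) (c : ℝ)
    (α : Fin m → ℝ) (hα : ∀ j, 0 < α j)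
    (hbal : (∑ j ∈ Finset.univ.filter fun j : Fin m => (j : ℕ) < a, 1 / α j) =
            (∑ j ∈ Finset.univ.filter fun j : Fin m => a ≤ (j : ℕ), 1 / α j))
    (u : ℝ → ℝ) (θ : Fin m → ℝ → ℝ)
    (hpos : ∀ j : Fin m, ∀ t : ℝ, 0 < (if (j : ℕ) < a then α j + u t else α j - u t))
    (hu : ∀ t : ℝ,
      HasDerivAt u (2 * Real.sqrt (quadProd a α (u t)) * Real.cos (∑ j, θ j t)) t)
    (hθ : ∀ j : Fin m, ∀ t : ℝ,
      HasDerivAt (θ j)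
        (if (j : ℕ) < a then
          -(Real.sqrt (quadProd a α (u t)) * Real.sin (∑ i, θ i t)) / (α j + u t)
        else
          (Real.sqrt (quadProd a α (u t)) * Real.sin (∑ i, θ i t)) / (α j - u t)) t)
    (A : ℝ) (hA : ∀ t : ℝ, Real.sqrt (quadProd a α (u t)) * Real.sin (∑ j, θ j t) = A)
    (hA0 : 0 < A) (hA1 : A < Real.sqrt (∏ j, α j))
    (T : ℝ) (hT : 0 < T)
    (huT : Function.Periodic u T)
    (hθT : Function.Periodic (fun t => ∑ j, θ j t) T)
    (aInt : Fin m → ℤ) (b : ℕ) (hb : 0 < b)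
    (hβ : ∀ (j : Fin m) (t : ℝ),
      θ j (t + T) = θ j t + Real.pi * (aInt j : ℝ) / (b : ℝ))
    (Φ : ℝ → (Fin m → ℝ) → (Fin m → ℂ))
    (hΦ : ∀ t x, Φ t x = fun j => wFun a α u θ j t * (x j : ℂ))
    (N : Set (Fin m → ℂ))
    (hN : N = {z | ∃ (t : ℝ) (x : Fin m → ℝ),
      (∑ j, qsign a j * x j ^ 2 = c) ∧ z = Φ t x}) :
    -- (i) periodicity of the `w_j` and of `Φ`
    ((∀ (j : Fin m) (t : ℝ),
        wFun a α u θ j (t + (b : ℝ) * T) = (-1 : ℂ) ^ (aInt j) * wFun a α u θ j t) ∧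
      ∀ (t : ℝ) (x : Fin m → ℝ), Φ (t + 2 * (b : ℝ) * T) x = Φ t x) ∧
    -- (ii) `N` is closed
    IsClosed N ∧
    -- (iii) away from `x = 0` the spanned tangent planes are special Lagrangian
    (∀ (t : ℝ) (x : Fin m → ℝ), (∑ j, qsign a j * x j ^ 2 = c) → x ≠ 0 →
      ∀ V : Submodule ℝ (Fin m → ℂ),
        V = Submodule.span ℝ
          (({fun j : Fin m => deriv (fun τ => wFun a α u θ j τ) t * (x j : ℂ)} :
              Set (Fin m → ℂ)) ∪
           {z | ∃ y : Fin m → ℝ, (∑ j, qsign a j * x j * y j = 0) ∧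
              z = fun j => wFun a α u θ j t * (y j : ℂ)}) →
        Module.finrank ℝ V = m ∧ IsSpecialLagrangianPlane V) ∧
    -- (iv) for `c = 0`, `N` is a cone with vertex `0 ∈ N`
    (c = 0 → (∀ r : ℝ, 0 < r → r • N = N) ∧ (0 : Fin m → ℂ) ∈ N) := by
  have hwper := fun j => wFun_add_nat_mul a α u θ j T huT (aInt j) b hb (hβ j)
  have hw0 : ∀ j t, wFun a α u θ j t ≠ 0 := fun j t => wFun_ne_zero a α u θ j t (hpos j t)
  have hper : ∀ j, Function.Periodic (wFun a α u θ j) (2 * (b : ℝ) * T) := by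
    intro j t
    have : t + 2 * (b : ℝ) * T = t + b * T + b * T := by ring
    rw [this, hwper, hwper, ← mul_assoc, ← mul_zpow]
    simp
  have hb' : (0 : ℝ) < b := by exact_mod_cast hb
  refine ⟨⟨hwper, fun t x => ?_⟩, ?_, ?_, ?_⟩
  · rw [hΦ, hΦ]
    exact funext fun j => by rw [hper]
  · have huc : Continuous u := continuous_iff_continuousAt.mpr fun t => (hu t).continuousAt
    have hθc : ∀ j, Continuous (θ j) := fun j =>
      continuous_iff_continuousAt.mpr fun t => (hθ j t).continuousAt
    have := isClosed_sweep (fun j => wFun a α u θ j)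
      (fun j => continuous_wFun a α u θ j huc (hθc j)) hw0 (2 * b * T) (by positivity) hper
      {x | ∑ j, qsign a j * x j ^ 2 = c} (isClosed_eq (by fun_prop) continuous_const)
    rw [hN]
    simp only [hΦ]
    exact this
  · intro t x _ hx V hV
    set S := ∑ j, θ j t with hS
    set Q := Real.sqrt (quadProd a α (u t)) with hQ
    have hQ0 : 0 < Q := Real.sqrt_pos.mpr (Finset.prod_pos fun j _ => hpos j t)
    have hprod : (∏ j, wFun a α u θ j t) * (Q * Complex.exp (-(S * Complex.I))) =
        ((Q ^ 2 : ℝ) : ℂ) := by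
      rw [prod_wFun a α u θ t fun j => hpos j t, ← hS, ← hQ]
      have : Complex.exp (Complex.I * S) * Complex.exp (-(S * Complex.I)) = 1 := by
        rw [← Complex.exp_add]
        ring_nf
        exact Complex.exp_zero
      push_cast
      linear_combination (Q : ℂ) ^ 2 * this
    have hn : (fun j => qsign a j * x j) ≠ 0 := by
      obtain ⟨i, hi⟩ := Function.ne_iff.mp hx
      refine Function.ne_iff.mpr ⟨i, mul_ne_zero ?_ hi⟩
      unfold qsign
      split_ifs <;> norm_num
    have hSL := isSpecialLagrangianPlane_span (fun j => wFun a α u θ j t)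
      (quadFactor a α (u t)) (fun j => qsign a j * x j) (fun j => hpos j t)
      (fun j => wFun_mul_conj a α u θ j t (hpos j t)) hn
      (Q * Complex.exp (-(S * Complex.I)))
      (by
        rw [hprod]
        exact_mod_cast (pow_pos hQ0 2).ne')
      (by rw [hprod, Complex.ofReal_im])
    have hd : (fun j : Fin m => deriv (fun τ => wFun a α u θ j τ) t * (x j : ℂ)) =
        fun j => Q * Complex.exp (-(S * Complex.I)) * wFun a α u θ j t *
          ((qsign a j * x j / quadFactor a α (u t) j : ℝ) : ℂ) := by
      funext j
      rw [(hasDerivAt_wFun a α u θ j t S Q (hpos j t) (hu t) (hθ j t)).deriv]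
      push_cast
      ring
    rw [← hd] at hSL
    subst hV
    exact ⟨hSL.1, hSL⟩
  · rintro rfl
    have hsub : ∀ r : ℝ, ∀ z ∈ N, r • z ∈ N := by
      intro r z hz
      rw [hN] at hz ⊢
      obtain ⟨t, x, hx, rfl⟩ := hz
      refine ⟨t, r • x, ?_, ?_⟩
      · simp only [Pi.smul_apply, smul_eq_mul, mul_pow, mul_left_comm (qsign a _),
          ← Finset.mul_sum, hx, mul_zero]
      · rw [hΦ, hΦ]
        ext j
        simp only [Pi.smul_apply, Complex.real_smul, smul_eq_mul]
        push_cast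
        ring
    refine ⟨fun r hr => ?_, ?_⟩
    · refine Set.Subset.antisymm ?_ fun z hz => ?_
      · rintro _ ⟨z, hz, rfl⟩
        exact hsub r z hz
      · rw [Set.mem_smul_set_iff_inv_smul_mem₀ hr.ne']
        exact hsub _ z hz
    · rw [hN]
      exact ⟨0, 0, by simp, by rw [hΦ]; ext j; simp⟩
end

section
/- Let m ≥ 2 and (m−1)/2 ≤ a ≤ m−1. Suppose w₁,…,w_{m−1} : (−ε,ε) → ℂ∖{0} and β : (−ε,ε) → ℂ are differentiable functions satisfying dw_j/dt = conj(w₁⋯w_{j−1}w_{j+1}⋯w_{m−1}) for j = 1,…,a, dw_j/dt = −conj(w₁⋯w_{j−1}w_{j+1}⋯w_{m−1}) for j = a+1,…,m−1, and dβ/dt = conj(w₁⋯w_{m−1}). Then for every t ∈ (−ε,ε) and every x ∈ ℝᵐ with x₁²+⋯+x_a² − x_{a+1}²−⋯−x_{m−1}² + 2x_m = 0, the real subspace of ℂᵐ spanned by the vector (w₁′(t)x₁,…,w_{m−1}′(t)x_{m−1}, β′(t)) together with all vectors (w₁(t)y₁,…,w_{m−1}(t)y_{m−1}, y_m) for y ∈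 ℝᵐ satisfying x₁y₁+⋯+x_ay_a − x_{a+1}y_{a+1}−⋯−x_{m−1}y_{m−1} + y_m = 0 is, whenever it has real dimension m, a special Lagrangian plane; hence N = {(w₁(t)x₁,…,w_{m−1}(t)x_{m−1}, x_m + β(t)) : t ∈ (−ε,ε), x ∈ ℝᵐ, x₁²+⋯+x_a² − x_{a+1}²−⋯−x_{m−1}² + 2x_m = 0} is a special Lagrangian submanifold of ℂᵐ wherever it is nonsingular. -/
open scoped ComplexConjugate

open Matrix in
theorem Matrix.det_add_smul_vecMulVec {n R : Type*} [Fintype n] [DecidableEq n] [CommRing R]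
    (A : Matrix n n R) (z : R) (u v : n → R) :
    (A + z • vecMulVec u v).det =
      A.det + z * (fromBlocks A (replicateCol Unit u) (-replicateRow Unit v) 0).det := by
  have h := det_fromBlocks_one₂₂ A (replicateCol Unit u) (-(z • replicateRow Unit v))
  have hA : A - replicateCol Unit u * -(z • replicateRow Unit v) = A + z • vecMulVec u v := by
    ext i j
    simp [Matrix.mul_apply, vecMulVec_apply]
  rw [hA] at h
  set M := fromBlocks A (replicateCol Unit u) (-replicateRow Unit v) 0 with hM
  have hrow : fromBlocks A (replicateCol Unit u) (-(z • replicateRow Unit v)) 1 =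
      M.updateRow (Sum.inr ()) (z • M (Sum.inr ()) + Sum.elim (0 : n → R) (1 : Unit → R)) := by
    ext (i | i) (j | j) <;> simp [hM, updateRow_apply, fromBlocks]
  have hA' : (M.updateRow (Sum.inr ()) (Sum.elim (0 : n → R) (1 : Unit → R))).det = A.det := by
    have : M.updateRow (Sum.inr ()) (Sum.elim (0 : n → R) (1 : Unit → R)) =
        fromBlocks A (replicateCol Unit u) 0 1 := by
      ext (i | i) (j | j) <;> simp [hM, updateRow_apply, fromBlocks]
    rw [this, det_fromBlocks_zero₂₁]
    simp
  rw [← h, hrow, det_updateRow_add, det_updateRow_smul, updateRow_eq_self, hA', add_comm]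

/-- The vectors `D · (c z u + y)` with `c` real, `y` real and `∑ |D i|² u i y i = 0`. -/
noncomputable def twistedHyperplane {k : ℕ} (D : Fin k → ℂ) (z : ℂ) (u : Fin k → ℝ) :
    Submodule ℝ (Fin k → ℂ) where
  carrier := {v | ∃ (c : ℝ) (y : Fin k → ℝ), ∑ i, Complex.normSq (D i) * u i * y i = 0 ∧
    v = fun i => D i * (y i + z * (u i * c))}
  zero_mem' := ⟨0, 0, by simp, by ext; simp⟩
  add_mem' := by
    rintro _ _ ⟨c, y, hy, rfl⟩ ⟨c', y', hy', rfl⟩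
    refine ⟨c + c', y + y', ?_, ?_⟩
    · simp [mul_add, Finset.sum_add_distrib, hy, hy']
    · ext i
      simp
      ring
  smul_mem' := by
    rintro r _ ⟨c, y, hy, rfl⟩
    refine ⟨r * c, r • y, ?_, ?_⟩
    · simp [mul_left_comm _ r, ← Finset.mul_sum, hy]
    · ext i
      simp
      ring

theorem omegaForm_eq_zero_of_mem_twistedHyperplane {k : ℕ} {D : Fin k → ℂ} {z : ℂ}
    {u : Fin k → ℝ} {v v' : Fin k → ℂ} (hv : v ∈ twistedHyperplane D z u)
    (hv' : v' ∈ twistedHyperplane D z u) : omegaForm v v' = 0 := by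
  obtain ⟨c, y, hy, rfl⟩ := hv
  obtain ⟨c', y', hy', rfl⟩ := hv'
  have key : hermInner (fun i => D i * (y i + z * (u i * c)))
      (fun i => D i * (y' i + z * (u i * c'))) =
      ((∑ i, Complex.normSq (D i) * (y i * y' i) +
        Complex.normSq z * c * c' * ∑ i, Complex.normSq (D i) * u i ^ 2 : ℝ) : ℂ) +
      conj z * c' * ((∑ i, Complex.normSq (D i) * u i * y i : ℝ) : ℂ) +
      z * c * ((∑ i, Complex.normSq (D i) * u i * y' i : ℝ) : ℂ) := by
    simp only [hermInner, Complex.ofReal_add, Complex.ofReal_mul, Complex.ofReal_sum,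
      Complex.ofReal_pow, Finset.mul_sum, ← Finset.sum_add_distrib, ← Complex.mul_conj, map_mul,
      map_add, Complex.conj_ofReal]
    exact Finset.sum_congr rfl fun i _ => by ring
  rw [omegaForm, key, hy, hy', Complex.ofReal_zero, mul_zero, mul_zero, add_zero, add_zero,
    Complex.ofReal_im]

theorem OmegaForm_im_eq_zero_of_mem_twistedHyperplane {k : ℕ} {D : Fin k → ℂ} {z : ℂ}
    {u : Fin k → ℝ} (hz : ((∏ i, D i) * z).im = 0)
    (hne : ∃ i, Complex.normSq (D i) * u i ≠ 0) {v : Fin k → (Fin k → ℂ)}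
    (hv : ∀ i, v i ∈ twistedHyperplane D z u) : (OmegaForm v).im = 0 := by
  choose c y hy hvy using hv
  let A : Matrix (Fin k) (Fin k) ℝ := Matrix.of fun i j => y j i
  have hA : A.det = 0 := by
    refine Matrix.exists_vecMul_eq_zero_iff.mp ⟨fun i => Complex.normSq (D i) * u i, ?_, ?_⟩
    · exact fun h => hne.elim fun i hi => hi (congrFun h i)
    · ext j
      exact hy j
  let N : Matrix (Fin k ⊕ Unit) (Fin k ⊕ Unit) ℝ :=
    Matrix.fromBlocks A (Matrix.replicateCol Unit u) (-Matrix.replicateRow Unit c) 0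
  have hdet : OmegaForm v = (∏ i, D i) * (z * (N.det : ℂ)) := by
    have hmul : (Matrix.of fun i j => v j i) = Matrix.of fun i j => D i *
        (A.map Complex.ofRealHom + z • Matrix.vecMulVec (fun i => (u i : ℂ))
          (fun j => (c j : ℂ))) i j := by
      ext i j
      simp [hvy, A, Matrix.vecMulVec_apply]
    have hN : N.map Complex.ofRealHom = Matrix.fromBlocks (A.map Complex.ofRealHom)
        (Matrix.replicateCol Unit fun i => (u i : ℂ))
        (-Matrix.replicateRow Unit fun j => (c j : ℂ)) 0 := by
      ext (i | i) (j | j) <;> simp [N]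
    have hA' : (A.map Complex.ofRealHom).det = 0 := by
      rw [← RingHom.mapMatrix_apply, ← RingHom.map_det, hA, map_zero]
    rw [OmegaForm, hmul, Matrix.det_mul_column, Matrix.det_add_smul_vecMulVec, ← hN, hA', zero_add,
      ← RingHom.mapMatrix_apply, ← RingHom.map_det]
    rfl
  rw [hdet, ← mul_assoc, Complex.im_mul_ofReal, hz, zero_mul]

/-- Evolving non-centred quadrics (the ambient dimension is written as
`m + 1`, so there are `m` functions `w_j` and one function `β`): if
`dw_j/dt = ± conj(w₁⋯ŵ_j⋯w_m)` and `dβ/dt = conj(w₁⋯w_m)`, then along the paraboloid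
`x₁²+⋯+x_a² − x_{a+1}²−⋯−x_m² + 2x_{m+1} = 0` the real span of
`(w₁′x₁,…,w_m′x_m, β′)` together with the vectors `(w₁y₁,…,w_my_m, y_{m+1})` for `y`
tangent to the paraboloid is a special Lagrangian plane whenever its real dimension is
`m + 1`. -/
theorem evolving_noncentred_quadrics_special_lagrangian
    (m a : ℕ) (hm : 1 ≤ m) (ha1 : m ≤ 2 * a) (ham : a ≤ m) (ε : ℝ)
    (w : Fin m → ℝ → ℂ) (B : ℝ → ℂ)
    (hw0 : ∀ j, ∀ t ∈ Set.Ioo (-ε) ε, w j t ≠ 0)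
    (hode : ∀ j, ∀ t ∈ Set.Ioo (-ε) ε,
      HasDerivAt (w j)
        ((if (j : ℕ) < a then 1 else -1) * conj (∏ k ∈ Finset.univ.erase j, w k t)) t)
    (hodeB : ∀ t ∈ Set.Ioo (-ε) ε, HasDerivAt B (conj (∏ k, w k t)) t)
    (t : ℝ) (ht : t ∈ Set.Ioo (-ε) ε) (x : Fin (m + 1) → ℝ)
    (hx : ∑ j : Fin m, qsign a j * x (Fin.castSucc j) ^ 2 + 2 * x (Fin.last m) = 0) :
    ∀ V : Submodule ℝ (Fin (m + 1) → ℂ),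
      V = Submodule.span ℝ
        (({Fin.snoc
            (fun j : Fin m => ((if (j : ℕ) < a then 1 else -1) *
              conj (∏ k ∈ Finset.univ.erase j, w k t)) * (x (Fin.castSucc j) : ℂ))
            (conj (∏ k, w k t))} : Set (Fin (m + 1) → ℂ)) ∪
         {z | ∃ y : Fin (m + 1) → ℝ,
            (∑ j : Fin m, qsign a j * x (Fin.castSucc j) * y (Fin.castSucc j)
              + y (Fin.last m) = 0) ∧
            z = Fin.snoc (fun j : Fin m => w j t * (y (Fin.castSucc j) : ℂ))
              ((y (Fin.last m) : ℂ))}) →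
      Module.finrank ℝ V = m + 1 → IsSpecialLagrangianPlane V := by
  intro V hspan hV
  set z : ℂ := conj (∏ k, w k t) with hz
  set D : Fin (m + 1) → ℂ := Fin.snoc (fun j => w j t) 1 with hD
  set u : Fin (m + 1) → ℝ :=
    Fin.snoc (fun j => qsign a j * x (Fin.castSucc j) / Complex.normSq (w j t)) 1 with hu
  have hsum (y : Fin (m + 1) → ℝ) : ∑ i, Complex.normSq (D i) * u i * y i =
      ∑ j : Fin m, qsign a j * x (Fin.castSucc j) * y (Fin.castSucc j) + y (Fin.last m) := by
    rw [Fin.sum_univ_castSucc]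
    simp only [hD, hu, Fin.snoc_castSucc, Fin.snoc_last, map_one, one_mul]
    congr 1
    refine Finset.sum_congr rfl fun j _ => ?_
    rw [mul_div_cancel₀ _ (Complex.normSq_pos.mpr (hw0 j t ht)).ne']
  have hle : V ≤ twistedHyperplane D z u := by
    rw [hspan]
    refine Submodule.span_le.mpr (Set.union_subset (Set.singleton_subset_iff.mpr ?_) ?_)
    rotate_left
    · rintro _ ⟨y, hy, rfl⟩
      refine ⟨0, y, (hsum y).trans hy, ?_⟩
      ext i
      refine Fin.lastCases ?_ (fun j => ?_) i <;> simp [hD]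
    · refine ⟨1, 0, by simp, ?_⟩
      ext i
      refine Fin.lastCases (by simp [hD, hu]) (fun j => ?_) i
      have hw := hw0 j t ht
      have hw' : conj (w j t) ≠ 0 := (map_ne_zero _).mpr hw
      have hprod : z = conj (w j t) * conj (∏ k ∈ Finset.univ.erase j, w k t) := by
        rw [hz, ← Finset.mul_prod_erase _ _ (Finset.mem_univ j), map_mul]
      have hs : ((qsign a j : ℝ) : ℂ) = if (j : ℕ) < a then 1 else -1 := by
        unfold qsign
        split_ifs <;> simp
      simp only [hD, hu, Fin.snoc_castSucc, Pi.zero_apply, Complex.ofReal_zero, zero_add,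
        Complex.ofReal_one, mul_one, Complex.ofReal_div, Complex.ofReal_mul, hs,
        ← Complex.mul_conj]
      rw [hprod]
      field_simp
  refine ⟨hV, fun v hv v' hv' =>
    omegaForm_eq_zero_of_mem_twistedHyperplane (hle hv) (hle hv'), fun v hv =>
    OmegaForm_im_eq_zero_of_mem_twistedHyperplane ?_ ⟨Fin.last m, by simp [hD, hu]⟩
      fun i => hle (hv i)⟩
  rw [hD, Fin.prod_snoc, mul_one, hz, Complex.mul_conj, Complex.ofReal_im]
end
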